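/- arXiv:2303.01474 — 3 statements merged into one kernel-verified Lean document; each statement's English description precedes it below -/
import Mathlib

section
/- Let ȳ ∈ S(x̄) and assume f, g are twice continuously differentiable and −f(x,·), g_i(x,·) are convex on ℝᵐ for every x near x̄. Suppose MFCQ holds for the system g(x̄,y) ≤ 0 at ȳ, and for every λ ∈ Σ(x̄,ȳ) the second order sufficient condition holds: dᵀ∇²_{yy}L(x̄,ȳ,λ)d < 0 for all nonzero d in the critical cone C(x̄,ȳ). Then V is Lipschitz continuous near x̄ and ∂V(x̄) ⊆ {∇_x L(x̄,ȳ,λ) : λ ∈ Σ(x̄,ȳ)}. -/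
open Filter Topology Metric RealInnerProductSpace

noncomputable section

/-- Feasible region of the parametric maximization problem. -/
def Feas {n m q : ℕ} (g : EuclideanSpace ℝ (Fin n) → EuclideanSpace ℝ (Fin m) → Fin q → ℝ)
    (x : EuclideanSpace ℝ (Fin n)) : Set (EuclideanSpace ℝ (Fin m)) :=
  {y | ∀ i, g x y i ≤ 0}

/-- Maximal value function (EReal valued; `sSup ∅ = ⊥ = -∞`). -/
def Vfun {n m q : ℕ} (f : EuclideanSpace ℝ (Fin n) → EuclideanSpace ℝ (Fin m) → ℝ)
    (g : EuclideanSpace ℝ (Fin n) → EuclideanSpace ℝ (Fin m) → Fin q → ℝ)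
    (x : EuclideanSpace ℝ (Fin n)) : EReal :=
  sSup ((fun y => (f x y : EReal)) '' Feas g x)

/-- Solution map of the parametric maximization problem. -/
def Sol {n m q : ℕ} (f : EuclideanSpace ℝ (Fin n) → EuclideanSpace ℝ (Fin m) → ℝ)
    (g : EuclideanSpace ℝ (Fin n) → EuclideanSpace ℝ (Fin m) → Fin q → ℝ)
    (x : EuclideanSpace ℝ (Fin n)) : Set (EuclideanSpace ℝ (Fin m)) :=
  {y ∈ Feas g x | (f x y : EReal) = Vfun f g x}

/-- Lagrangian `L(x,y,λ) = f(x,y) - λᵀ g(x,y)`. -/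
def Lag {n m q : ℕ} (f : EuclideanSpace ℝ (Fin n) → EuclideanSpace ℝ (Fin m) → ℝ)
    (g : EuclideanSpace ℝ (Fin n) → EuclideanSpace ℝ (Fin m) → Fin q → ℝ)
    (x : EuclideanSpace ℝ (Fin n)) (y : EuclideanSpace ℝ (Fin m)) (lam : Fin q → ℝ) : ℝ :=
  f x y - ∑ i, lam i * g x y i

/-- Partial gradient in `x`. -/
def gradx {n m : ℕ} (φ : EuclideanSpace ℝ (Fin n) → EuclideanSpace ℝ (Fin m) → ℝ)
    (x : EuclideanSpace ℝ (Fin n)) (y : EuclideanSpace ℝ (Fin m)) : EuclideanSpace ℝ (Fin n) :=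
  gradient (fun x' => φ x' y) x

/-- Partial gradient in `y`. -/
def grady {n m : ℕ} (φ : EuclideanSpace ℝ (Fin n) → EuclideanSpace ℝ (Fin m) → ℝ)
    (x : EuclideanSpace ℝ (Fin n)) (y : EuclideanSpace ℝ (Fin m)) : EuclideanSpace ℝ (Fin m) :=
  gradient (fun y' => φ x y') y

/-- `∇_y L(x,y,λ)`. -/
def gradyL {n m q : ℕ} (f : EuclideanSpace ℝ (Fin n) → EuclideanSpace ℝ (Fin m) → ℝ)
    (g : EuclideanSpace ℝ (Fin n) → EuclideanSpace ℝ (Fin m) → Fin q → ℝ)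
    (x : EuclideanSpace ℝ (Fin n)) (y : EuclideanSpace ℝ (Fin m)) (lam : Fin q → ℝ) :
    EuclideanSpace ℝ (Fin m) :=
  grady (fun x y => Lag f g x y lam) x y

/-- `∇_x L(x,y,λ)`. -/
def gradxL {n m q : ℕ} (f : EuclideanSpace ℝ (Fin n) → EuclideanSpace ℝ (Fin m) → ℝ)
    (g : EuclideanSpace ℝ (Fin n) → EuclideanSpace ℝ (Fin m) → Fin q → ℝ)
    (x : EuclideanSpace ℝ (Fin n)) (y : EuclideanSpace ℝ (Fin m)) (lam : Fin q → ℝ) :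
    EuclideanSpace ℝ (Fin n) :=
  gradx (fun x y => Lag f g x y lam) x y

/-- `∇_y g(x,y)ᵀ u ∈ ℝ^q`. -/
def gyTu {n m q : ℕ} (g : EuclideanSpace ℝ (Fin n) → EuclideanSpace ℝ (Fin m) → Fin q → ℝ)
    (x : EuclideanSpace ℝ (Fin n)) (y : EuclideanSpace ℝ (Fin m)) (u : EuclideanSpace ℝ (Fin m)) :
    Fin q → ℝ :=
  fun i => ⟪grady (fun x y => g x y i) x y, u⟫

/-- `∇²_{yy} L(x,y,λ) u`. -/
def hessyyLu {n m q : ℕ} (f : EuclideanSpace ℝ (Fin n) → EuclideanSpace ℝ (Fin m) → ℝ)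
    (g : EuclideanSpace ℝ (Fin n) → EuclideanSpace ℝ (Fin m) → Fin q → ℝ)
    (x : EuclideanSpace ℝ (Fin n)) (y : EuclideanSpace ℝ (Fin m)) (lam : Fin q → ℝ)
    (u : EuclideanSpace ℝ (Fin m)) : EuclideanSpace ℝ (Fin m) :=
  gradient (fun y' => ⟪gradyL f g x y' lam, u⟫) y

/-- `∇²_{xy} L(x,y,λ) u ∈ ℝⁿ` (for `u ∈ ℝᵐ`). -/
def hessxyLu {n m q : ℕ} (f : EuclideanSpace ℝ (Fin n) → EuclideanSpace ℝ (Fin m) → ℝ)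
    (g : EuclideanSpace ℝ (Fin n) → EuclideanSpace ℝ (Fin m) → Fin q → ℝ)
    (x : EuclideanSpace ℝ (Fin n)) (y : EuclideanSpace ℝ (Fin m)) (lam : Fin q → ℝ)
    (u : EuclideanSpace ℝ (Fin m)) : EuclideanSpace ℝ (Fin n) :=
  gradient (fun x' => ⟪gradyL f g x' y lam, u⟫) x

/-- Multiplier set `Σ(x,y)`. -/
def SigmaSet {n m q : ℕ} (f : EuclideanSpace ℝ (Fin n) → EuclideanSpace ℝ (Fin m) → ℝ)
    (g : EuclideanSpace ℝ (Fin n) → EuclideanSpace ℝ (Fin m) → Fin q → ℝ)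
    (x : EuclideanSpace ℝ (Fin n)) (y : EuclideanSpace ℝ (Fin m)) : Set (Fin q → ℝ) :=
  {lam | gradyL f g x y lam = 0 ∧ (∀ i, 0 ≤ lam i) ∧ (∀ i, g x y i ≤ 0) ∧
    ∑ i, lam i * g x y i = 0}

/-- Singular multiplier set `Σ⁰(x,y)`. -/
def SigmaZero {n m q : ℕ} (g : EuclideanSpace ℝ (Fin n) → EuclideanSpace ℝ (Fin m) → Fin q → ℝ)
    (x : EuclideanSpace ℝ (Fin n)) (y : EuclideanSpace ℝ (Fin m)) : Set (Fin q → ℝ) :=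
  {lam | ∑ i, lam i • grady (fun x y => g x y i) x y = 0 ∧ (∀ i, 0 ≤ lam i) ∧
    (∀ i, g x y i ≤ 0) ∧ ∑ i, lam i * g x y i = 0}

/-- The set `Ξ^r(x,y,λ)`. -/
def XiSet {n m q : ℕ} (r : ℝ) (f : EuclideanSpace ℝ (Fin n) → EuclideanSpace ℝ (Fin m) → ℝ)
    (g : EuclideanSpace ℝ (Fin n) → EuclideanSpace ℝ (Fin m) → Fin q → ℝ)
    (x : EuclideanSpace ℝ (Fin n)) (y : EuclideanSpace ℝ (Fin m)) (lam : Fin q → ℝ) :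
    Set (EuclideanSpace ℝ (Fin m)) :=
  {u | hessyyLu f g x y lam u = 0 ∧ (∀ i, 0 ≤ -(gyTu g x y u i) - r * g x y i) ∧
    (∀ i, 0 ≤ lam i) ∧ ∑ i, lam i * (-(gyTu g x y u i) - r * g x y i) = 0}

/-- Fréchet (regular) subdifferential of an `EReal` valued function. -/
def FSub {n : ℕ} (φ : EuclideanSpace ℝ (Fin n) → EReal) (x₀ : EuclideanSpace ℝ (Fin n)) :
    Set (EuclideanSpace ℝ (Fin n)) :=
  {v | ∃ c : ℝ, φ x₀ = (c : EReal) ∧ ∀ ε : ℝ, 0 < ε → ∃ δ : ℝ, 0 < δ ∧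
    ∀ x, ‖x - x₀‖ < δ → ((c + ⟪v, x - x₀⟫ - ε * ‖x - x₀‖ : ℝ) : EReal) ≤ φ x}

/-- Limiting (Mordukhovich) subdifferential. -/
def LSub {n : ℕ} (φ : EuclideanSpace ℝ (Fin n) → EReal) (x₀ : EuclideanSpace ℝ (Fin n)) :
    Set (EuclideanSpace ℝ (Fin n)) :=
  {v | ∃ (xk : ℕ → EuclideanSpace ℝ (Fin n)) (vk : ℕ → EuclideanSpace ℝ (Fin n)),
    (∀ k, vk k ∈ FSub φ (xk k)) ∧ Tendsto xk atTop (𝓝 x₀) ∧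
    Tendsto (fun k => φ (xk k)) atTop (𝓝 (φ x₀)) ∧ Tendsto vk atTop (𝓝 v)}

/-- Horizon (singular) subdifferential. -/
def HorSub {n : ℕ} (φ : EuclideanSpace ℝ (Fin n) → EReal) (x₀ : EuclideanSpace ℝ (Fin n)) :
    Set (EuclideanSpace ℝ (Fin n)) :=
  {v | ∃ (xk : ℕ → EuclideanSpace ℝ (Fin n)) (vk : ℕ → EuclideanSpace ℝ (Fin n)) (tk : ℕ → ℝ),
    (∀ k, vk k ∈ FSub φ (xk k)) ∧ (∀ k, 0 < tk k) ∧ Tendsto tk atTop (𝓝 0) ∧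
    Tendsto xk atTop (𝓝 x₀) ∧ Tendsto (fun k => φ (xk k)) atTop (𝓝 (φ x₀)) ∧
    Tendsto (fun k => tk k • vk k) atTop (𝓝 v)}

/-- Clarke subdifferential (for locally Lipschitz functions): convex hull of the limiting one. -/
def CSub {n : ℕ} (φ : EuclideanSpace ℝ (Fin n) → EReal) (x₀ : EuclideanSpace ℝ (Fin n)) :
    Set (EuclideanSpace ℝ (Fin n)) :=
  convexHull ℝ (LSub φ x₀)

/-- `φ` is (finite-valued and) Lipschitz continuous near `x₀`. -/
def LipschitzNearAt {n : ℕ} (φ : EuclideanSpace ℝ (Fin n) → EReal)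
    (x₀ : EuclideanSpace ℝ (Fin n)) : Prop :=
  ∃ δ : ℝ, 0 < δ ∧ ∃ K : NNReal, ∃ ψ : EuclideanSpace ℝ (Fin n) → ℝ,
    LipschitzWith K ψ ∧ ∀ x ∈ ball x₀ δ, φ x = (ψ x : EReal)

/-- Regular (Fréchet) normal cone. -/
def regNC {n : ℕ} (C : Set (EuclideanSpace ℝ (Fin n))) (x₀ : EuclideanSpace ℝ (Fin n)) :
    Set (EuclideanSpace ℝ (Fin n)) :=
  {ξ | ∀ ε : ℝ, 0 < ε → ∃ δ : ℝ, 0 < δ ∧ ∀ x ∈ C, ‖x - x₀‖ < δ →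
    ⟪ξ, x - x₀⟫ ≤ ε * ‖x - x₀‖}

/-- Limiting (Mordukhovich) normal cone. -/
def limNC {n : ℕ} (C : Set (EuclideanSpace ℝ (Fin n))) (x₀ : EuclideanSpace ℝ (Fin n)) :
    Set (EuclideanSpace ℝ (Fin n)) :=
  {ξ | ∃ (xk : ℕ → EuclideanSpace ℝ (Fin n)) (ξk : ℕ → EuclideanSpace ℝ (Fin n)),
    (∀ k, xk k ∈ C) ∧ (∀ k, ξk k ∈ regNC C (xk k)) ∧
    Tendsto xk atTop (𝓝 x₀) ∧ Tendsto ξk atTop (𝓝 ξ)}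

/-- Inner semicontinuity of the solution map at `(x̄, ȳ)`. -/
def InnerSemicont {n m q : ℕ} (f : EuclideanSpace ℝ (Fin n) → EuclideanSpace ℝ (Fin m) → ℝ)
    (g : EuclideanSpace ℝ (Fin n) → EuclideanSpace ℝ (Fin m) → Fin q → ℝ)
    (xb : EuclideanSpace ℝ (Fin n)) (yb : EuclideanSpace ℝ (Fin m)) : Prop :=
  ∀ xk : ℕ → EuclideanSpace ℝ (Fin n), Tendsto xk atTop (𝓝 xb) →
    ∃ yk : ℕ → EuclideanSpace ℝ (Fin m), (∀ k, yk k ∈ Sol f g (xk k)) ∧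
      Tendsto yk atTop (𝓝 yb)

/-- Local error bound for the system `g(x,y) ≤ 0` at `(x̄, ȳ)`. -/
def LocalErrorBound {n m q : ℕ}
    (g : EuclideanSpace ℝ (Fin n) → EuclideanSpace ℝ (Fin m) → Fin q → ℝ)
    (xb : EuclideanSpace ℝ (Fin n)) (yb : EuclideanSpace ℝ (Fin m)) : Prop :=
  ∃ κ δ : ℝ, 0 < κ ∧ 0 < δ ∧
    ∀ x y, ‖((x, y) : EuclideanSpace ℝ (Fin n) × EuclideanSpace ℝ (Fin m)) - (xb, yb)‖ < δ →
      Metric.infDist ((x, y) : EuclideanSpace ℝ (Fin n) × EuclideanSpace ℝ (Fin m))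
          {p : EuclideanSpace ℝ (Fin n) × EuclideanSpace ℝ (Fin m) | ∀ i, g p.1 p.2 i ≤ 0}
        ≤ κ * ∑ i, max (g x y i) 0

/-- MFCQ for the system `g(x̄, ·) ≤ 0` at `ȳ`. -/
def MFCQy {n m q : ℕ} (g : EuclideanSpace ℝ (Fin n) → EuclideanSpace ℝ (Fin m) → Fin q → ℝ)
    (xb : EuclideanSpace ℝ (Fin n)) (yb : EuclideanSpace ℝ (Fin m)) : Prop :=
  ∀ lam : Fin q → ℝ, (∀ i, 0 ≤ lam i) → (∑ i, lam i * g xb yb i = 0) →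
    (∀ i, g xb yb i ≤ 0) → (∑ i, lam i • grady (fun x y => g x y i) xb yb = 0) → lam = 0

/-- Restricted sup-compactness at `x̄`. -/
def RestrictedSupCompact {n m q : ℕ}
    (f : EuclideanSpace ℝ (Fin n) → EuclideanSpace ℝ (Fin m) → ℝ)
    (g : EuclideanSpace ℝ (Fin n) → EuclideanSpace ℝ (Fin m) → Fin q → ℝ)
    (xb : EuclideanSpace ℝ (Fin n)) : Prop :=
  (∃ c : ℝ, Vfun f g xb = (c : EReal)) ∧
  ∃ ε δ : ℝ, 0 < ε ∧ 0 < δ ∧ ∃ Ω : Set (EuclideanSpace ℝ (Fin m)), IsCompact Ω ∧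
    ∀ x, ‖x - xb‖ < δ → Vfun f g xb - (ε : EReal) < Vfun f g x → (Sol f g x ∩ Ω).Nonempty

/-- Robinson stability of the feasible map at `(x̄, ȳ)`. -/
def RobinsonStability {n m q : ℕ}
    (g : EuclideanSpace ℝ (Fin n) → EuclideanSpace ℝ (Fin m) → Fin q → ℝ)
    (xb : EuclideanSpace ℝ (Fin n)) (yb : EuclideanSpace ℝ (Fin m)) : Prop :=
  ∃ κ δ : ℝ, 0 < κ ∧ 0 < δ ∧
    ∀ x y, ‖((x, y) : EuclideanSpace ℝ (Fin n) × EuclideanSpace ℝ (Fin m)) - (xb, yb)‖ < δ →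
      Metric.infDist y (Feas g x) ≤ κ * ∑ i, max (g x y i) 0

/-- A constraint qualification holds at the feasible point `w₀` of the system
`{w : G w ≤ 0, H w = 0}`: local minimizers of C¹ functions over the feasible set
satisfy the KKT conditions. -/
def CQAt {W : Type} [NormedAddCommGroup W] [NormedSpace ℝ W] {p p' : ℕ}
    (G : W → Fin p → ℝ) (H : W → Fin p' → ℝ) (w₀ : W) : Prop :=
  ∀ θ : W → ℝ, ContDiff ℝ 1 θ →
    IsLocalMinOn θ {w | (∀ i, G w i ≤ 0) ∧ ∀ j, H w j = 0} w₀ →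
    ∃ (lam : Fin p → ℝ) (mu : Fin p' → ℝ), (∀ i, 0 ≤ lam i) ∧
      (fderiv ℝ θ w₀ + ∑ i, lam i • fderiv ℝ (fun w => G w i) w₀ +
        ∑ j, mu j • fderiv ℝ (fun w => H w j) w₀ = 0) ∧
      ∑ i, lam i * G w₀ i = 0

/-- Inequality constraints of the Wolfe dual system (`λ ≥ 0`). -/
def WolfeG (n m q : ℕ) :
    (EuclideanSpace ℝ (Fin n) × EuclideanSpace ℝ (Fin m) × (Fin q → ℝ)) → Fin q → ℝ :=
  fun w i => -(w.2.2 i)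

/-- Equality constraints of the Wolfe dual system (`∇_y L(x,y,λ) = 0`). -/
def WolfeH {n m q : ℕ} (f : EuclideanSpace ℝ (Fin n) → EuclideanSpace ℝ (Fin m) → ℝ)
    (g : EuclideanSpace ℝ (Fin n) → EuclideanSpace ℝ (Fin m) → Fin q → ℝ) :
    (EuclideanSpace ℝ (Fin n) × EuclideanSpace ℝ (Fin m) × (Fin q → ℝ)) → Fin m → ℝ :=
  fun w j => gradyL f g w.1 w.2.1 w.2.2 j

/-- The multiplier set `M(β, x, y)` of the parametric program. -/
def MultSetP {n m q : ℕ} (g : EuclideanSpace ℝ (Fin n) → EuclideanSpace ℝ (Fin m) → Fin q → ℝ)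
    (β : EuclideanSpace ℝ (Fin m)) (x : EuclideanSpace ℝ (Fin n))
    (y : EuclideanSpace ℝ (Fin m)) : Set (Fin q → ℝ) :=
  {lam | β - ∑ i, lam i • grady (fun x y => g x y i) x y = 0 ∧ (∀ i, 0 ≤ lam i) ∧
    ∑ i, lam i * g x y i = 0 ∧ ∀ i, g x y i ≤ 0}

/-- A stable parametric CQ holds at `ȳ ∈ F(x̄)` for the parametric system `g(x,·) ≤ 0`. -/
def StableParamCQ {n m q : ℕ} (f : EuclideanSpace ℝ (Fin n) → EuclideanSpace ℝ (Fin m) → ℝ)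
    (g : EuclideanSpace ℝ (Fin n) → EuclideanSpace ℝ (Fin m) → Fin q → ℝ)
    (xb : EuclideanSpace ℝ (Fin n)) (yb : EuclideanSpace ℝ (Fin m)) : Prop :=
  ∃ P : EuclideanSpace ℝ (Fin n) → EuclideanSpace ℝ (Fin m) → Prop,
    (∃ δ : ℝ, 0 < δ ∧ ∀ x y, y ∈ Feas g x → ‖x - xb‖ < δ → ‖y - yb‖ < δ → P x y) ∧
    (∀ x y, P x y → y ∈ Feas g x → IsLocalMaxOn (f x) (Feas g x) y →
      (MultSetP g (grady f x y) x y).Nonempty) ∧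
    (∀ (βk : ℕ → EuclideanSpace ℝ (Fin m)) (xk : ℕ → EuclideanSpace ℝ (Fin n))
        (yk : ℕ → EuclideanSpace ℝ (Fin m)) (βb : EuclideanSpace ℝ (Fin m)),
      Tendsto βk atTop (𝓝 βb) → Tendsto xk atTop (𝓝 xb) → Tendsto yk atTop (𝓝 yb) →
      (∀ k, (MultSetP g (βk k) (xk k) (yk k)).Nonempty) →
      ∃ (lamk : ℕ → Fin q → ℝ) (φ : ℕ → ℕ) (lamb : Fin q → ℝ),
        StrictMono φ ∧ (∀ k, lamk k ∈ MultSetP g (βk k) (xk k) (yk k)) ∧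
        Tendsto (lamk ∘ φ) atTop (𝓝 lamb) ∧ lamb ∈ MultSetP g βb xb yb)

/-- The multiplier set `M(β, w)` of a (nonparametric) system `{w : G w ≤ 0, H w = 0}`. -/
def MultSetW {W : Type} [NormedAddCommGroup W] [NormedSpace ℝ W] {p p' : ℕ}
    (G : W → Fin p → ℝ) (H : W → Fin p' → ℝ) (β : W →L[ℝ] ℝ) (w : W) :
    Set ((Fin p → ℝ) × (Fin p' → ℝ)) :=
  {lm | (∀ i, 0 ≤ lm.1 i) ∧
    (β - ∑ i, lm.1 i • fderiv ℝ (fun w => G w i) w -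
      ∑ j, lm.2 j • fderiv ℝ (fun w => H w j) w = 0) ∧
    ∑ i, lm.1 i * G w i = 0}

/-- A stable CQ holds at the feasible point `w̄` of the system `{w : G w ≤ 0, H w = 0}`. -/
def StableCQ {W : Type} [NormedAddCommGroup W] [NormedSpace ℝ W] {p p' : ℕ}
    (G : W → Fin p → ℝ) (H : W → Fin p' → ℝ) (wb : W) : Prop :=
  ∃ P : W → Prop,
    (P wb ∧ ∃ δ : ℝ, 0 < δ ∧ ∀ w, (∀ i, G w i ≤ 0) → (∀ j, H w j = 0) → ‖w - wb‖ < δ → P w) ∧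
    (∀ w, P w → (∀ i, G w i ≤ 0) → (∀ j, H w j = 0) →
      ∀ θ : W → ℝ, ContDiff ℝ 1 θ →
        IsLocalMinOn θ {w' | (∀ i, G w' i ≤ 0) ∧ ∀ j, H w' j = 0} w →
        ∃ (lam : Fin p → ℝ) (mu : Fin p' → ℝ), (∀ i, 0 ≤ lam i) ∧
          (fderiv ℝ θ w + ∑ i, lam i • fderiv ℝ (fun w => G w i) w +
            ∑ j, mu j • fderiv ℝ (fun w => H w j) w = 0) ∧
          ∑ i, lam i * G w i = 0) ∧
    (∀ (βk : ℕ → W →L[ℝ] ℝ) (wk : ℕ → W) (βb : W →L[ℝ] ℝ),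
      Tendsto βk atTop (𝓝 βb) → Tendsto wk atTop (𝓝 wb) →
      (∀ k, (∀ i, G (wk k) i ≤ 0) ∧ ∀ j, H (wk k) j = 0) →
      (∀ k, (MultSetW G H (βk k) (wk k)).Nonempty) →
      ∃ (lmk : ℕ → (Fin p → ℝ) × (Fin p' → ℝ)) (φ : ℕ → ℕ) (lmb : (Fin p → ℝ) × (Fin p' → ℝ)),
        StrictMono φ ∧ (∀ k, lmk k ∈ MultSetW G H (βk k) (wk k)) ∧
        Tendsto (lmk ∘ φ) atTop (𝓝 lmb) ∧ lmb ∈ MultSetW G H βb wb)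

/-- Critical cone of `(P_x̄)` at `y` associated with the multiplier `λ`. -/
def CritCone {n m q : ℕ} (g : EuclideanSpace ℝ (Fin n) → EuclideanSpace ℝ (Fin m) → Fin q → ℝ)
    (xb : EuclideanSpace ℝ (Fin n)) (y : EuclideanSpace ℝ (Fin m)) (lam : Fin q → ℝ) :
    Set (EuclideanSpace ℝ (Fin m)) :=
  {d | ∀ i, g xb y i = 0 →
    (0 < lam i → ⟪grady (fun x y => g x y i) xb y, d⟫ = 0) ∧
    (lam i = 0 → ⟪grady (fun x y => g x y i) xb y, d⟫ ≤ 0)}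

/-- Second order sufficient condition at `(y, λ)` for `(P_x̄)`. -/
def SOSC {n m q : ℕ} (f : EuclideanSpace ℝ (Fin n) → EuclideanSpace ℝ (Fin m) → ℝ)
    (g : EuclideanSpace ℝ (Fin n) → EuclideanSpace ℝ (Fin m) → Fin q → ℝ)
    (xb : EuclideanSpace ℝ (Fin n)) (y : EuclideanSpace ℝ (Fin m)) (lam : Fin q → ℝ) : Prop :=
  ∀ d ∈ CritCone g xb y lam, d ≠ 0 → ⟪d, hessyyLu f g xb y lam d⟫ < 0

/-- `(x̄, ȳ)` is a local solution of the minimax problem in the sense of Stackelberg. -/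
def StackelbergLocal {n m q : ℕ} (f : EuclideanSpace ℝ (Fin n) → EuclideanSpace ℝ (Fin m) → ℝ)
    (g : EuclideanSpace ℝ (Fin n) → EuclideanSpace ℝ (Fin m) → Fin q → ℝ)
    (X : Set (EuclideanSpace ℝ (Fin n))) (xb : EuclideanSpace ℝ (Fin n))
    (yb : EuclideanSpace ℝ (Fin m)) : Prop :=
  xb ∈ X ∧ yb ∈ Sol f g xb ∧ IsLocalMinOn (Vfun f g) X xb

/-- Feasible region of the MPEC reformulation `(P_MPEC)`. -/
def MPECFeas {n m q : ℕ} (f : EuclideanSpace ℝ (Fin n) → EuclideanSpace ℝ (Fin m) → ℝ)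
    (g : EuclideanSpace ℝ (Fin n) → EuclideanSpace ℝ (Fin m) → Fin q → ℝ)
    (X : Set (EuclideanSpace ℝ (Fin n))) :
    Set (EuclideanSpace ℝ (Fin n) × EuclideanSpace ℝ (Fin m) × (Fin q → ℝ)) :=
  {w | w.1 ∈ X ∧ gradyL f g w.1 w.2.1 w.2.2 = 0 ∧ (∀ i, g w.1 w.2.1 i ≤ 0) ∧
    (∀ i, 0 ≤ w.2.2 i) ∧ ∑ i, w.2.2 i * g w.1 w.2.1 i = 0}

/-- S-stationarity for `(P_MPEC)`. -/
def SStationary {n m q : ℕ} (f : EuclideanSpace ℝ (Fin n) → EuclideanSpace ℝ (Fin m) → ℝ)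
    (g : EuclideanSpace ℝ (Fin n) → EuclideanSpace ℝ (Fin m) → Fin q → ℝ)
    (X : Set (EuclideanSpace ℝ (Fin n))) (xb : EuclideanSpace ℝ (Fin n))
    (yb : EuclideanSpace ℝ (Fin m)) (lamb : Fin q → ℝ) : Prop :=
  ∃ (u : EuclideanSpace ℝ (Fin m)) (α β : Fin q → ℝ),
    -(gradx f xb yb + ∑ i, α i • gradx (fun x y => g x y i) xb yb +
        hessxyLu f g xb yb lamb u) ∈ limNC X xb ∧
    grady f xb yb + ∑ i, α i • grady (fun x y => g x y i) xb yb +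
      hessyyLu f g xb yb lamb u = 0 ∧
    (∀ i, -(gyTu g xb yb u i) - β i = 0) ∧
    (∀ i, g xb yb i < 0 → lamb i = 0 → α i = 0) ∧
    (∀ i, g xb yb i = 0 → 0 < lamb i → β i = 0) ∧
    (∀ i, g xb yb i = 0 → lamb i = 0 → 0 ≤ α i ∧ 0 ≤ β i)


/-- Optimal value function of the Wolfe dual (`sInf ∅ = ⊤`). -/
def VD {n m q : ℕ} (f : EuclideanSpace ℝ (Fin n) → EuclideanSpace ℝ (Fin m) → ℝ)
    (g : EuclideanSpace ℝ (Fin n) → EuclideanSpace ℝ (Fin m) → Fin q → ℝ)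
    (x : EuclideanSpace ℝ (Fin n)) : EReal :=
  sInf ((fun p : EuclideanSpace ℝ (Fin m) × (Fin q → ℝ) => (Lag f g x p.1 p.2 : EReal)) ''
    {p | gradyL f g x p.1 p.2 = 0 ∧ ∀ i, 0 ≤ p.2 i})

/-- Strict differentiability of an `EReal`-valued function at `x₀` with gradient `ζ`. -/
def StrictDiffAt {n : ℕ} (φ : EuclideanSpace ℝ (Fin n) → EReal)
    (x₀ ζ : EuclideanSpace ℝ (Fin n)) : Prop :=
  ∀ ε : ℝ, 0 < ε → ∃ δ : ℝ, 0 < δ ∧ ∀ x x', ‖x - x₀‖ < δ → ‖x' - x₀‖ < δ →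
    ∃ a b : ℝ, φ x = (a : EReal) ∧ φ x' = (b : EReal) ∧
      |a - b - ⟪ζ, x - x'⟫| ≤ ε * ‖x - x'‖

/-- `f` and `g` are separable with respect to `x` and `y`. -/
def SeparableFG {n m q : ℕ} (f : EuclideanSpace ℝ (Fin n) → EuclideanSpace ℝ (Fin m) → ℝ)
    (g : EuclideanSpace ℝ (Fin n) → EuclideanSpace ℝ (Fin m) → Fin q → ℝ) : Prop :=
  ∃ (f₁ : EuclideanSpace ℝ (Fin n) → ℝ) (f₂ : EuclideanSpace ℝ (Fin m) → ℝ)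
    (g₁ : EuclideanSpace ℝ (Fin n) → Fin q → ℝ) (g₂ : EuclideanSpace ℝ (Fin m) → Fin q → ℝ),
    (∀ x y, f x y = f₁ x + f₂ y) ∧ ∀ x y i, g x y i = g₁ x i + g₂ y i

end

/-- Gordan-type theorem of the alternative for finitely many convex functions. -/
theorem exists_nonneg_combination_of_convexOn {ι F : Type*} [Fintype ι] [AddCommGroup F]
    [Module ℝ F] {h : ι → F → ℝ} (hh : ∀ i, ConvexOn ℝ Set.univ (h i))
    (hpos : ∀ y, ∃ i, 0 ≤ h i y) :
    ∃ lam : ι → ℝ, (∀ i, 0 ≤ lam i) ∧ lam ≠ 0 ∧ ∀ y, 0 ≤ ∑ i, lam i * h i y := by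
  classical
  set A : Set (ι → ℝ) := {z | ∃ y, ∀ i, h i y < z i} with hA
  have hconv : Convex ℝ A := by
    rintro z ⟨y, hy⟩ z' ⟨y', hy'⟩ a b ha hb hab
    refine ⟨a • y + b • y', fun i => ?_⟩
    have h1 := (hh i).2 (Set.mem_univ y) (Set.mem_univ y') ha hb hab
    have h2 := hy i
    have h3 := hy' i
    simp only [smul_eq_mul, Pi.add_apply, Pi.smul_apply] at h1 ⊢
    rcases ha.eq_or_lt with rfl | ha
    · obtain rfl : b = 1 := by linarith
      linarith
    · have := mul_lt_mul_of_pos_left h2 ha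
      have := mul_le_mul_of_nonneg_left h3.le hb
      linarith
  have hopen : IsOpen A := by
    have : A = ⋃ y, ⋂ i, {z : ι → ℝ | h i y < z i} := by ext; simp [hA]
    rw [this]
    exact isOpen_iUnion fun y => isOpen_iInter_of_finite fun i =>
      isOpen_lt continuous_const (continuous_apply i)
  have h0 : (0 : ι → ℝ) ∉ A := by
    rintro ⟨y, hy⟩
    obtain ⟨i, hi⟩ := hpos y
    exact absurd (hy i) (not_lt.mpr hi)
  obtain ⟨ℓ, hℓ⟩ := geometric_hahn_banach_point_open hconv hopen h0
  simp only [map_zero] at hℓ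
  have hsum : ∀ z, ℓ z = ∑ i, ℓ (Pi.single i 1) * z i := by
    intro z
    conv_lhs => rw [← Finset.univ_sum_single z]
    rw [map_sum]
    refine Finset.sum_congr rfl fun i _ => ?_
    have : (Pi.single i (z i) : ι → ℝ) = z i • Pi.single i 1 := by
      rw [← Pi.single_smul]; simp
    rw [this, map_smul, smul_eq_mul, mul_comm]
  have hmem : ∀ y, (fun i => h i y + 1) ∈ A := fun y => ⟨y, fun i => by simp⟩
  refine ⟨fun i => ℓ (Pi.single i 1), fun i => ?_, fun h => ?_, fun y => ?_⟩
  · by_contra! hneg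
    set z : ι → ℝ := fun i => h i 0 + 1
    have hz := hℓ z (hmem 0)
    set t := ℓ z / -ℓ (Pi.single i 1)
    have ht : 0 ≤ t := div_nonneg hz.le (by linarith)
    have hzt : z + t • Pi.single i 1 ∈ A := by
      refine ⟨0, fun j => ?_⟩
      have : 0 ≤ (Pi.single i 1 : ι → ℝ) j := by
        by_cases hij : j = i
        · subst hij; simp
        · simp [hij]
      have := mul_nonneg ht this
      simp only [Pi.add_apply, Pi.smul_apply, smul_eq_mul, z]
      linarith
    have h1 := hℓ _ hzt
    have h2 : t * -ℓ (Pi.single i 1) = ℓ z := div_mul_cancel₀ _ (by linarith)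
    rw [map_add, map_smul, smul_eq_mul] at h1
    linarith
  · have := hℓ _ (hmem 0)
    rw [hsum] at this
    simp [fun i => congrFun h i] at this
  · refine le_of_forall_pos_lt_add fun ε hε => ?_
    set S := ∑ i, |ℓ (Pi.single i 1)|
    have hS : 0 ≤ S := Finset.sum_nonneg fun i _ => abs_nonneg _
    have hη : 0 < ε / (S + 1) := by positivity
    have h1 := hℓ (fun i => h i y + ε / (S + 1)) ⟨y, fun i => by linarith⟩
    rw [hsum] at h1
    simp only [mul_add, Finset.sum_add_distrib, ← Finset.sum_mul] at h1
    have h2 : (∑ i, ℓ (Pi.single i 1)) * (ε / (S + 1)) ≤ S * (ε / (S + 1)) :=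
      mul_le_mul_of_nonneg_right (Finset.sum_le_sum fun i _ => le_abs_self _) hη.le
    have h3 : (S + 1) * (ε / (S + 1)) = ε := mul_div_cancel₀ _ (by positivity)
    linarith

/-- Lagrange multipliers for a concave program satisfying the Slater condition. -/
theorem exists_multiplier_of_slater {ι F : Type*} [Fintype ι] [AddCommGroup F] [Module ℝ F]
    {φ : F → ℝ} {h : F → ι → ℝ} (hφ : ConcaveOn ℝ Set.univ φ)
    (hh : ∀ i, ConvexOn ℝ Set.univ fun y => h y i) {y₀ : F} (hy₀ : ∀ i, h y₀ i < 0) {c : ℝ}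
    (hc : ∀ y, (∀ i, h y i ≤ 0) → φ y ≤ c) :
    ∃ lam : ι → ℝ, (∀ i, 0 ≤ lam i) ∧ ∀ y, φ y - ∑ i, lam i * h y i ≤ c := by
  let H : Option ι → F → ℝ := fun o y => o.elim (c - φ y) (h y)
  have hH : ∀ o, ConvexOn ℝ Set.univ (H o) := by
    rintro (_ | i)
    · exact (convexOn_const c convex_univ).sub hφ
    · exact hh i
  obtain ⟨lam, hlam, hne, hsum⟩ := exists_nonneg_combination_of_convexOn hH fun y => by
    by_contra! hneg
    have := hc y fun i => (hneg (some i)).le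
    have := hneg none
    simp only [H, Option.elim] at this
    linarith
  simp only [Fintype.sum_option, H, Option.elim] at hsum
  have hpos : 0 < lam none := by
    refine (hlam none).lt_of_ne' fun h0 => hne ?_
    have h1 := hsum y₀
    rw [h0, zero_mul, zero_add] at h1
    have h2 : ∀ i ∈ Finset.univ, lam (some i) * h y₀ i ≤ 0 := fun i _ =>
      mul_nonpos_of_nonneg_of_nonpos (hlam _) (hy₀ i).le
    have h3 := (Finset.sum_eq_zero_iff_of_nonpos h2).1 (le_antisymm (Finset.sum_nonpos h2) h1)
    funext o
    rcases o with _ | i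
    · exact h0
    · exact (mul_eq_zero.1 (h3 i (Finset.mem_univ i))).resolve_right (hy₀ i).ne
  refine ⟨fun i => lam (some i) / lam none, fun i => div_nonneg (hlam _) hpos.le, fun y => ?_⟩
  have h1 := hsum y
  have h2 : ∑ i, lam (some i) / lam none * h y i = (∑ i, lam (some i) * h y i) / lam none := by
    rw [Finset.sum_div]
    exact Finset.sum_congr rfl fun i _ => by ring
  rw [h2, sub_le_iff_le_add, ← sub_le_iff_le_add', le_div_iff₀ hpos]
  linarith

/-- The directional derivative is nonpositive along a segment on which the function is. -/
theorem inner_gradient_nonpos {F : Type*} [NormedAddCommGroup F] [InnerProductSpace ℝ F]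
    [CompleteSpace F] {φ : F → ℝ} {y d : F} (hφ : DifferentiableAt ℝ φ y) (h0 : φ y = 0)
    (hle : ∀ t ∈ Set.Icc (0 : ℝ) 1, φ (y + t • d) ≤ 0) : ⟪gradient φ y, d⟫ ≤ 0 := by
  have hd : HasDerivAt (fun t : ℝ => y + t • d) d 0 := by
    simpa using ((hasDerivAt_id (0 : ℝ)).smul_const d).const_add y
  have h1 : HasDerivAt (fun t : ℝ => φ (y + t • d)) ⟪gradient φ y, d⟫ 0 := by
    have h2 : HasFDerivAt φ (InnerProductSpace.toDual ℝ F (gradient φ y)) (y + (0 : ℝ) • d) := by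
      simpa using hφ.hasGradientAt.hasFDerivAt
    exact h2.comp_hasDerivAt 0 hd
  have h2 := h1.hasDerivWithinAt (s := Set.Ioi 0)
  have h3 : Tendsto (slope (fun t : ℝ => φ (y + t • d)) 0) (𝓝[>] (0 : ℝ))
      (𝓝 ⟪gradient φ y, d⟫) := (hasDerivWithinAt_iff_tendsto_slope' (lt_irrefl 0)).1 h2
  refine le_of_tendsto h3 ?_
  filter_upwards [Ioc_mem_nhdsGT (zero_lt_one (α := ℝ))] with t ht
  rw [slope_def_field]
  simp only [zero_smul, add_zero, h0, sub_zero]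
  exact div_nonpos_of_nonpos_of_nonneg (hle t ⟨ht.1.le, ht.2⟩) ht.1.le

theorem IsLocalMax.gradient_eq_zero {F : Type*} [NormedAddCommGroup F] [InnerProductSpace ℝ F]
    [CompleteSpace F] {φ : F → ℝ} {y : F} (h : IsLocalMax φ y) : gradient φ y = 0 := by
  rw [gradient, h.fderiv_eq_zero, map_zero]

section Parametric

variable {n m q : ℕ} {f : EuclideanSpace ℝ (Fin n) → EuclideanSpace ℝ (Fin m) → ℝ}
  {g : EuclideanSpace ℝ (Fin n) → EuclideanSpace ℝ (Fin m) → Fin q → ℝ}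
  {xb : EuclideanSpace ℝ (Fin n)} {yb : EuclideanSpace ℝ (Fin m)}

theorem contDiff_partial_right {k : WithTop ℕ∞}
    {φ : EuclideanSpace ℝ (Fin n) → EuclideanSpace ℝ (Fin m) → ℝ}
    (hφ : ContDiff ℝ k fun p : EuclideanSpace ℝ (Fin n) × EuclideanSpace ℝ (Fin m) => φ p.1 p.2)
    (x : EuclideanSpace ℝ (Fin n)) : ContDiff ℝ k (φ x) :=
  hφ.comp (contDiff_const.prodMk contDiff_id)

theorem inner_gradx {φ : EuclideanSpace ℝ (Fin n) → EuclideanSpace ℝ (Fin m) → ℝ}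
    {x : EuclideanSpace ℝ (Fin n)} {y : EuclideanSpace ℝ (Fin m)}
    (hφ : DifferentiableAt ℝ
      (fun p : EuclideanSpace ℝ (Fin n) × EuclideanSpace ℝ (Fin m) => φ p.1 p.2) (x, y))
    (u : EuclideanSpace ℝ (Fin n)) :
    ⟪gradx φ x y, u⟫ = fderiv ℝ
      (fun p : EuclideanSpace ℝ (Fin n) × EuclideanSpace ℝ (Fin m) => φ p.1 p.2) (x, y) (u, 0) := by
  rw [gradx, inner_gradient_left]
  have h : HasFDerivAt (fun x' => φ x' y) _ x :=
    hφ.hasFDerivAt.comp x (f := fun x' => (x', y)) (hasFDerivAt_prodMk_left x y)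
  rw [h.fderiv]
  simp

theorem gradxL_eq
    (hf : ContDiff ℝ 2 (fun p : EuclideanSpace ℝ (Fin n) × EuclideanSpace ℝ (Fin m) => f p.1 p.2))
    (hg : ∀ i, ContDiff ℝ 2
      (fun p : EuclideanSpace ℝ (Fin n) × EuclideanSpace ℝ (Fin m) => g p.1 p.2 i))
    (x : EuclideanSpace ℝ (Fin n)) (y : EuclideanSpace ℝ (Fin m)) (lam : Fin q → ℝ) :
    gradxL f g x y lam = gradx f x y - ∑ i, lam i • gradx (fun x y => g x y i) x y := by
  have hf' : DifferentiableAt ℝ (fun x' => f x' y) x :=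
    ((hf.differentiable two_ne_zero).comp
      (differentiable_id.prodMk (differentiable_const y))).differentiableAt
  have hg' : ∀ i, DifferentiableAt ℝ (fun x' => g x' y i) x := fun i =>
    (((hg i).differentiable two_ne_zero).comp
      (differentiable_id.prodMk (differentiable_const y))).differentiableAt
  have h : HasFDerivAt (fun x' => Lag f g x' y lam)
      (fderiv ℝ (fun x' => f x' y) x - ∑ i, lam i • fderiv ℝ (fun x' => g x' y i) x) x :=
    hf'.hasFDerivAt.sub (HasFDerivAt.fun_sum fun i _ => (hg' i).hasFDerivAt.const_mul (lam i))
  simp only [gradxL, gradx, gradient, h.fderiv, map_sub, map_sum, map_smul]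

/-- In the convex case, the dual form of MFCQ yields a Slater point. -/
theorem MFCQy.exists_slater
    (hg : ∀ i, ContDiff ℝ 2
      (fun p : EuclideanSpace ℝ (Fin n) × EuclideanSpace ℝ (Fin m) => g p.1 p.2 i))
    (hconv : ∀ i, ConvexOn ℝ Set.univ fun y => g xb y i) (hyb : yb ∈ Feas g xb)
    (h : MFCQy g xb yb) : ∃ y₀, ∀ i, g xb y₀ i < 0 := by
  by_contra! hno
  obtain ⟨lam, hlam, hne, hsum⟩ := exists_nonneg_combination_of_convexOn hconv hno
  have h0 : ∑ i, lam i * g xb yb i = 0 :=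
    le_antisymm (Finset.sum_nonpos fun i _ => mul_nonpos_of_nonneg_of_nonpos (hlam i) (hyb i))
      (hsum yb)
  refine hne (h lam hlam h0 hyb ?_)
  have hd : ∀ i, DifferentiableAt ℝ (fun y => g xb y i) yb := fun i =>
    ((contDiff_partial_right (φ := fun x y => g x y i) (hg i) xb).differentiable
      two_ne_zero).differentiableAt
  have hmin : IsLocalMin (fun y => ∑ i, lam i * g xb y i) yb :=
    Filter.Eventually.of_forall fun y => by simpa only [h0] using hsum y
  have hder : HasFDerivAt (fun y => ∑ i, lam i * g xb y i)
      (∑ i, lam i • fderiv ℝ (fun y => g xb y i) yb) yb :=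
    HasFDerivAt.fun_sum fun i _ => (hd i).hasFDerivAt.const_mul (lam i)
  have hz := hmin.hasFDerivAt_eq_zero hder
  simpa only [grady, gradient, map_sum, map_smul, map_zero] using
    congrArg (InnerProductSpace.toDual ℝ (EuclideanSpace ℝ (Fin m))).symm hz

theorem contDiff_Lag_right
    (hf : ContDiff ℝ 2 (fun p : EuclideanSpace ℝ (Fin n) × EuclideanSpace ℝ (Fin m) => f p.1 p.2))
    (hg : ∀ i, ContDiff ℝ 2
      (fun p : EuclideanSpace ℝ (Fin n) × EuclideanSpace ℝ (Fin m) => g p.1 p.2 i))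
    (x : EuclideanSpace ℝ (Fin n)) (lam : Fin q → ℝ) :
    ContDiff ℝ 2 fun y => Lag f g x y lam :=
  (contDiff_partial_right hf x).sub (ContDiff.sum fun i _ =>
    contDiff_const.mul (contDiff_partial_right (φ := fun x y => g x y i) (hg i) x))

theorem gradyL_eq_zero_of_forall_le {x : EuclideanSpace ℝ (Fin n)}
    {y : EuclideanSpace ℝ (Fin m)} {lam : Fin q → ℝ}
    (h : ∀ y', Lag f g x y' lam ≤ Lag f g x y lam) : gradyL f g x y lam = 0 :=
  IsLocalMax.gradient_eq_zero (Filter.Eventually.of_forall h)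

/-- A saddle-point multiplier at a feasible point belongs to the multiplier set. -/
theorem mem_SigmaSet_of_forall_Lag_le (hyb : yb ∈ Feas g xb) {lam : Fin q → ℝ}
    (hlam : ∀ i, 0 ≤ lam i) (h : ∀ y, Lag f g xb y lam ≤ f xb yb) :
    lam ∈ SigmaSet f g xb yb := by
  have h0 : ∑ i, lam i * g xb yb i = 0 :=
    le_antisymm (Finset.sum_nonpos fun i _ => mul_nonpos_of_nonneg_of_nonpos (hlam i) (hyb i))
      (by have := h yb; simp only [Lag] at this; linarith)
  refine ⟨gradyL_eq_zero_of_forall_le fun y => (h y).trans_eq ?_, hlam, hyb, h0⟩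
  simp [Lag, h0]

/-- For a concave program, the second order sufficient condition at one saddle-point multiplier
makes the maximizer unique. -/
theorem SOSC.eq_of_le
    (hf : ContDiff ℝ 2 (fun p : EuclideanSpace ℝ (Fin n) × EuclideanSpace ℝ (Fin m) => f p.1 p.2))
    (hg : ∀ i, ContDiff ℝ 2
      (fun p : EuclideanSpace ℝ (Fin n) × EuclideanSpace ℝ (Fin m) => g p.1 p.2 i))
    (hfc : ConcaveOn ℝ Set.univ (f xb)) (hgc : ∀ i, ConvexOn ℝ Set.univ fun y => g xb y i)
    (hyb : yb ∈ Feas g xb) {lam : Fin q → ℝ} (hlam : ∀ i, 0 ≤ lam i)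
    (hL : ∀ y, Lag f g xb y lam ≤ f xb yb) (hs : SOSC f g xb yb lam)
    {y : EuclideanSpace ℝ (Fin m)} (hy : y ∈ Feas g xb) (hle : f xb yb ≤ f xb y) : y = yb := by
  by_contra hne
  set d := y - yb with hd
  have hseg : ∀ t : ℝ, yb + t • d = (1 - t) • yb + t • y := fun t => by rw [hd]; module
  have hfeas : ∀ t ∈ Set.Icc (0 : ℝ) 1, yb + t • d ∈ Feas g xb := fun t ht i => by
    have h1 := (hgc i).2 (Set.mem_univ yb) (Set.mem_univ y) (sub_nonneg.2 ht.2) ht.1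
      (sub_add_cancel 1 t)
    rw [hseg]
    refine h1.trans ?_
    have := mul_nonpos_of_nonneg_of_nonpos (sub_nonneg.2 ht.2) (hyb i)
    have := mul_nonpos_of_nonneg_of_nonpos ht.1 (hy i)
    simp only [smul_eq_mul]
    linarith
  have hval : ∀ t ∈ Set.Icc (0 : ℝ) 1, f xb yb ≤ f xb (yb + t • d) := fun t ht => by
    have h1 := hfc.2 (Set.mem_univ yb) (Set.mem_univ y) (sub_nonneg.2 ht.2) ht.1
      (sub_add_cancel 1 t)
    have := mul_le_mul_of_nonneg_left hle ht.1
    rw [hseg]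
    simp only [smul_eq_mul] at h1
    linarith
  have hterm : ∀ t ∈ Set.Icc (0 : ℝ) 1, ∀ i ∈ Finset.univ, lam i * g xb (yb + t • d) i ≤ 0 :=
    fun t ht i _ => mul_nonpos_of_nonneg_of_nonpos (hlam i) (hfeas t ht i)
  have hmax : ∀ t ∈ Set.Icc (0 : ℝ) 1, f xb yb ≤ Lag f g xb (yb + t • d) lam := fun t ht => by
    have := Finset.sum_nonpos (hterm t ht)
    have := hval t ht
    simp only [Lag]
    linarith
  have hcompl : ∀ t ∈ Set.Icc (0 : ℝ) 1, ∀ i, lam i * g xb (yb + t • d) i = 0 := fun t ht i => by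
    refine (Finset.sum_eq_zero_iff_of_nonpos (hterm t ht)).1
      (le_antisymm (Finset.sum_nonpos (hterm t ht)) ?_) i (Finset.mem_univ i)
    have h1 := hL (yb + t • d)
    have h2 := hval t ht
    simp only [Lag] at h1
    linarith
  have hgrad : ∀ t ∈ Set.Icc (0 : ℝ) 1, gradyL f g xb (yb + t • d) lam = 0 := fun t ht =>
    gradyL_eq_zero_of_forall_le fun y' => (hL y').trans (hmax t ht)
  have hgd : ∀ i, DifferentiableAt ℝ (fun y => g xb y i) yb := fun i =>
    ((contDiff_partial_right (φ := fun x y => g x y i) (hg i) xb).differentiable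
      two_ne_zero).differentiableAt
  have hgle : ∀ i, g xb yb i = 0 → ⟪grady (fun x y => g x y i) xb yb, d⟫ ≤ 0 := fun i hi =>
    inner_gradient_nonpos (hgd i) hi fun t ht => hfeas t ht i
  have hcrit : d ∈ CritCone g xb yb lam := fun i hi => by
    refine ⟨fun hpos => le_antisymm (hgle i hi) ?_, fun _ => hgle i hi⟩
    have h1 := inner_gradient_nonpos (φ := fun y => -g xb y i) (d := d) (hgd i).neg (by simp [hi])
      fun t ht => by
        have := (mul_eq_zero.1 (hcompl t ht i)).resolve_left hpos.ne'
        simp [this]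
    rw [inner_gradient_left, fderiv_fun_neg] at h1
    rw [grady, inner_gradient_left]
    simpa using h1
  have hneg := hs d hcrit (sub_ne_zero.2 hne)
  have hpd : DifferentiableAt ℝ (fun y' => ⟪gradyL f g xb y' lam, d⟫) yb := by
    have : (fun y' => ⟪gradyL f g xb y' lam, d⟫) =
        fun y' => fderiv ℝ (fun y => Lag f g xb y lam) y' d :=
      funext fun y' => inner_gradient_left
    rw [this]
    have h1 := ((contDiff_Lag_right hf hg xb lam).fderiv_right (m := 1) (by norm_num))
    exact ((h1.differentiable one_ne_zero).differentiableAt).clm_apply (differentiableAt_const d)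
  have h0 := hgrad 0 ⟨le_rfl, zero_le_one⟩
  rw [zero_smul, add_zero] at h0
  have h1 := inner_gradient_nonpos (d := d) hpd.neg (by simp [h0]) fun t ht => by
    simp [hgrad t ht]
  rw [inner_gradient_left, fderiv_neg] at h1
  rw [hessyyLu, real_inner_comm, inner_gradient_left] at hneg
  simp only [neg_apply] at h1
  linarith


/-- If the concave program at `xb` has the unique solution `yb` and a Slater point, then the nearby
programs have solutions arbitrarily close to `yb`. -/
theorem eventually_exists_solution_mem_closedBall
    (hf : Continuous fun p : EuclideanSpace ℝ (Fin n) × EuclideanSpace ℝ (Fin m) => f p.1 p.2)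
    (hg : ∀ i, Continuous
      fun p : EuclideanSpace ℝ (Fin n) × EuclideanSpace ℝ (Fin m) => g p.1 p.2 i)
    (hconv : ∀ᶠ x in 𝓝 xb, ConcaveOn ℝ Set.univ (f x) ∧
      ∀ i, ConvexOn ℝ Set.univ fun y => g x y i)
    {y₀ : EuclideanSpace ℝ (Fin m)} (hy₀ : ∀ i, g xb y₀ i < 0) (hyb : yb ∈ Feas g xb)
    (huniq : ∀ y ∈ Feas g xb, f xb yb ≤ f xb y → y = yb) {r : ℝ} (hr : 0 < r) :
    ∀ᶠ x in 𝓝 xb, ∃ y ∈ closedBall yb r, y ∈ Feas g x ∧ ∀ y' ∈ Feas g x, f x y' ≤ f x y := by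
  set c : ℝ → EuclideanSpace ℝ (Fin m) := fun s => yb + s • (y₀ - yb) with hc
  have hcc : Continuous c := by fun_prop
  have hc0 : c 0 = yb := by simp [hc]
  have hsphere : ∀ᶠ p : ℝ × EuclideanSpace ℝ (Fin n) in 𝓝 (0, xb), ∀ y ∈ sphere yb r,
      (∃ i, 0 < g p.2 y i) ∨ f p.2 y < f p.2 (c p.1) := by
    refine (isCompact_sphere yb r).eventually_forall_of_forall_eventually fun y hy => ?_
    by_cases hyf : y ∈ Feas g xb
    · have hlt : f xb y < f xb (c 0) := by
        rw [hc0]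
        by_contra! h
        rw [huniq y hyf h] at hy
        simp only [mem_sphere, dist_self] at hy
        exact hr.ne hy
      have h1 : Continuous fun z : (ℝ × EuclideanSpace ℝ (Fin n)) × EuclideanSpace ℝ (Fin m) =>
          f z.1.2 z.2 := hf.comp (by fun_prop : Continuous fun z :
            (ℝ × EuclideanSpace ℝ (Fin n)) × EuclideanSpace ℝ (Fin m) => (z.1.2, z.2))
      have h2 : Continuous fun z : (ℝ × EuclideanSpace ℝ (Fin n)) × EuclideanSpace ℝ (Fin m) =>
          f z.1.2 (c z.1.1) := hf.comp (by fun_prop : Continuous fun z :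
            (ℝ × EuclideanSpace ℝ (Fin n)) × EuclideanSpace ℝ (Fin m) => (z.1.2, c z.1.1))
      have h3 := h1.continuousAt.eventually_lt (x₀ := ((0, xb), y)) h2.continuousAt hlt
      exact h3.mono fun z hz => Or.inr hz
    · simp only [Feas, Set.mem_ofPred_eq, not_forall, not_le] at hyf
      obtain ⟨i, hi⟩ := hyf
      have h1 : Continuous fun z : (ℝ × EuclideanSpace ℝ (Fin n)) × EuclideanSpace ℝ (Fin m) =>
          g z.1.2 z.2 i := (hg i).comp (by fun_prop : Continuous fun z :
            (ℝ × EuclideanSpace ℝ (Fin n)) × EuclideanSpace ℝ (Fin m) => (z.1.2, z.2))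
      have h3 := continuousAt_const.eventually_lt (x₀ := ((0, xb), y)) h1.continuousAt hi
      exact h3.mono fun z hz => Or.inl ⟨i, hz⟩
  rw [nhds_prod_eq] at hsphere
  have hball : ∀ᶠ s in 𝓝 (0 : ℝ), c s ∈ ball yb r :=
    hcc.continuousAt.eventually_mem (by rw [hc0]; exact ball_mem_nhds yb hr)
  obtain ⟨s, ⟨hs, hsb⟩, hs0, hs1⟩ :=
    (((hsphere.curry.and hball).filter_mono nhdsWithin_le_nhds).and
      (Ioc_mem_nhdsGT (zero_lt_one (α := ℝ)))).exists
  have hslater : ∀ i, g xb (c s) i < 0 := fun i => by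
    have h1 := (hconv.self_of_nhds.2 i).2 (Set.mem_univ yb) (Set.mem_univ y₀) (sub_nonneg.2 hs1)
      hs0.le (sub_add_cancel 1 s)
    have h2 : c s = (1 - s) • yb + s • y₀ := by rw [hc]; module
    have := mul_nonpos_of_nonneg_of_nonpos (sub_nonneg.2 hs1) (hyb i)
    have := mul_neg_of_pos_of_neg hs0 (hy₀ i)
    rw [h2]
    simp only [smul_eq_mul] at h1
    linarith
  have hfeas : ∀ᶠ x in 𝓝 xb, ∀ i, g x (c s) i < 0 := Filter.eventually_all.2 fun i =>
    ((hg i).comp (continuous_id.prodMk continuous_const)).continuousAt.eventually_lt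
      continuousAt_const (hslater i)
  filter_upwards [hs, hfeas, hconv] with x hx hxs hxc
  have hcs : c s ∈ Feas g x := fun i => (hxs i).le
  have hclosed : IsClosed (Feas g x) := by
    have : Feas g x = ⋂ i, {y | g x y i ≤ 0} := by ext; simp [Feas]
    rw [this]
    exact isClosed_iInter fun i => isClosed_le
      ((hg i).comp (continuous_const.prodMk continuous_id)) continuous_const
  obtain ⟨y, hy, hymax⟩ := ((isCompact_closedBall yb r).inter_right hclosed).exists_isMaxOn
    ⟨c s, ball_subset_closedBall hsb, hcs⟩
    (f := f x) (hf.comp (continuous_const.prodMk continuous_id)).continuousOn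
  refine ⟨y, hy.1, hy.2, fun y' hy' => ?_⟩
  by_cases hyr : y' ∈ closedBall yb r
  · exact hymax ⟨hyr, hy'⟩
  refine le_trans ?_ (hymax ⟨ball_subset_closedBall hsb, hcs⟩)
  -- the segment from `c s` to `y'` crosses the sphere
  let σ : ℝ → EuclideanSpace ℝ (Fin m) := fun t => (1 - t) • c s + t • y'
  have hσ : ContinuousOn (fun t => dist (σ t) yb) (Set.Icc 0 1) := by fun_prop
  obtain ⟨t, ht, htr⟩ : r ∈ (fun t => dist (σ t) yb) '' Set.Icc 0 1 := by
    refine intermediate_value_Icc zero_le_one hσ ⟨?_, ?_⟩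
    · simpa [σ] using (mem_ball.1 hsb).le
    · simpa [σ] using (not_le.1 (mt mem_closedBall.2 hyr)).le
  have hfeast : σ t ∈ Feas g x := fun i => by
    have h1 := (hxc.2 i).2 (Set.mem_univ (c s)) (Set.mem_univ y') (sub_nonneg.2 ht.2)
      ht.1 (sub_add_cancel 1 t)
    have := mul_nonpos_of_nonneg_of_nonpos (sub_nonneg.2 ht.2) (hcs i)
    have := mul_nonpos_of_nonneg_of_nonpos ht.1 (hy' i)
    simp only [smul_eq_mul] at h1
    linarith
  have hlt : f x (σ t) < f x (c s) := (hx (σ t) htr).resolve_left fun ⟨i, hi⟩ =>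
    absurd (hfeast i) (not_le.2 hi)
  have h1 := hxc.1.2 (Set.mem_univ (c s)) (Set.mem_univ y') (sub_nonneg.2 ht.2)
      ht.1 (sub_add_cancel 1 t)
  simp only [smul_eq_mul] at h1
  by_contra! hgt
  have := mul_le_mul_of_nonneg_left hgt.le ht.1
  have : f x (σ t) = f x ((1 - t) • c s + t • y') := rfl
  linarith

theorem eventually_abs_sub_inner_gradx_le
    {φ : EuclideanSpace ℝ (Fin n) → EuclideanSpace ℝ (Fin m) → ℝ}
    (hφ : ContDiff ℝ 2 fun p : EuclideanSpace ℝ (Fin n) × EuclideanSpace ℝ (Fin m) => φ p.1 p.2)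
    (xb : EuclideanSpace ℝ (Fin n)) (yb : EuclideanSpace ℝ (Fin m)) {ε : ℝ} (hε : 0 < ε) :
    ∀ᶠ p : EuclideanSpace ℝ (Fin n) × EuclideanSpace ℝ (Fin n) × EuclideanSpace ℝ (Fin m) in
      𝓝 (xb, xb, yb), |φ p.2.1 p.2.2 - φ p.1 p.2.2 - ⟪gradx φ xb yb, p.2.1 - p.1⟫| ≤
        ε * ‖p.2.1 - p.1‖ := by
  have h := (hφ.contDiffAt.hasStrictFDerivAt (x := (xb, yb)) two_ne_zero).isLittleO.def hε
  have ht : Tendsto (fun p : EuclideanSpace ℝ (Fin n) × EuclideanSpace ℝ (Fin n) ×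
      EuclideanSpace ℝ (Fin m) => ((p.2.1, p.2.2), (p.1, p.2.2))) (𝓝 (xb, xb, yb))
      (𝓝 ((xb, yb), (xb, yb))) :=
    Continuous.tendsto (by fun_prop) (xb, xb, yb)
  refine (ht.eventually h).mono fun ⟨x, x', y⟩ hp => ?_
  rw [inner_gradx ((hφ.differentiable two_ne_zero).differentiableAt)]
  simpa [Prod.norm_def, -map_sub] using hp

/-- One-sided first order estimate of the value function by saddle-point multipliers. -/
theorem exists_forall_value_sub_le
    (hf : ContDiff ℝ 2 (fun p : EuclideanSpace ℝ (Fin n) × EuclideanSpace ℝ (Fin m) => f p.1 p.2))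
    (hg : ∀ i, ContDiff ℝ 2
      (fun p : EuclideanSpace ℝ (Fin n) × EuclideanSpace ℝ (Fin m) => g p.1 p.2 i))
    {W : EuclideanSpace ℝ (Fin n) → ℝ}
    (hW : ∀ r : ℝ, 0 < r → ∀ᶠ x in 𝓝 xb, ∃ y ∈ closedBall yb r, y ∈ Feas g x ∧ f x y = W x)
    {M : ℝ} (hM : 0 ≤ M) {ε : ℝ} (hε : 0 < ε) :
    ∃ δ : ℝ, 0 < δ ∧ ∀ x ∈ ball xb δ, ∀ x' ∈ ball xb δ, ∀ lam : Fin q → ℝ,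
      (∀ i, 0 ≤ lam i) → (∀ i, lam i ≤ M) → (∀ y, Lag f g x y lam ≤ W x) →
      W x' - W x ≤ ⟪gradxL f g xb yb lam, x' - x⟫ + ε * ‖x' - x‖ := by
  set η := ε / (1 + q * M) with hη
  have hden : 0 < 1 + q * M := by positivity
  have hη0 : 0 < η := by positivity
  have hev := (eventually_abs_sub_inner_gradx_le hf xb yb hη0).and
    (Filter.eventually_all.2 fun i =>
      eventually_abs_sub_inner_gradx_le (φ := fun x y => g x y i) (hg i) xb yb hη0)
  obtain ⟨δ, hδ, hball⟩ := Metric.eventually_nhds_iff_ball.1 hev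
  obtain ⟨δ', hδ', hsol⟩ := Metric.eventually_nhds_iff_ball.1 (hW (δ / 2) (by positivity))
  refine ⟨min δ δ', lt_min hδ hδ', fun x hx x' hx' lam hlam hlamM hL => ?_⟩
  obtain ⟨y, hyr, hyf, hyW⟩ := hsol x' (ball_subset_ball (min_le_right _ _) hx')
  have hyδ : y ∈ ball yb δ := (mem_closedBall.1 hyr).trans_lt (half_lt_self hδ)
  obtain ⟨h1, h2⟩ := hball (x, x', y) (by
    rw [← ball_prod_same, ← ball_prod_same]
    exact ⟨ball_subset_ball (min_le_left _ _) hx, ball_subset_ball (min_le_left _ _) hx', hyδ⟩)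
  simp only at h1 h2
  have h3 : ∑ i, lam i * g x' y i ≤ 0 :=
    Finset.sum_nonpos fun i _ => mul_nonpos_of_nonneg_of_nonpos (hlam i) (hyf i)
  have h4 := hL y
  have h5 : ∑ i, lam i * (g x y i - g x' y i + ⟪gradx (fun x y => g x y i) xb yb, x' - x⟫) ≤
      ∑ _i : Fin q, M * (η * ‖x' - x‖) := Finset.sum_le_sum fun i _ => by
    have h6 := (abs_le.1 (h2 i)).1
    calc _ ≤ lam i * (η * ‖x' - x‖) := mul_le_mul_of_nonneg_left (by linarith) (hlam i)
      _ ≤ _ := mul_le_mul_of_nonneg_right (hlamM i) (by positivity)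
  simp only [mul_add, mul_sub, Finset.sum_add_distrib, Finset.sum_sub_distrib, Finset.sum_const,
    Finset.card_univ, Fintype.card_fin, nsmul_eq_mul] at h5
  have h6 := (abs_le.1 h1).2
  have h7 : η * ‖x' - x‖ + q * (M * (η * ‖x' - x‖)) = ε * ‖x' - x‖ := by
    rw [hη]; field_simp
  rw [gradxL_eq hf hg, inner_sub_left, sum_inner]
  simp only [inner_smul_left, Lag, conj_trivial] at h4 ⊢
  linarith

/-- Near a point admitting a Slater point, saddle-point multipliers exist and are uniformly
bounded. -/
theorem exists_bounded_multipliers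
    (hf : Continuous fun p : EuclideanSpace ℝ (Fin n) × EuclideanSpace ℝ (Fin m) => f p.1 p.2)
    (hg : ∀ i, Continuous
      fun p : EuclideanSpace ℝ (Fin n) × EuclideanSpace ℝ (Fin m) => g p.1 p.2 i)
    (hconv : ∀ᶠ x in 𝓝 xb, ConcaveOn ℝ Set.univ (f x) ∧
      ∀ i, ConvexOn ℝ Set.univ fun y => g x y i)
    {y₀ : EuclideanSpace ℝ (Fin m)} (hy₀ : ∀ i, g xb y₀ i < 0)
    {W : EuclideanSpace ℝ (Fin n) → ℝ}
    (hW : ∀ r : ℝ, 0 < r → ∀ᶠ x in 𝓝 xb, ∃ y ∈ closedBall yb r, y ∈ Feas g x ∧ f x y = W x)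
    (hle : ∀ᶠ x in 𝓝 xb, ∀ y ∈ Feas g x, f x y ≤ W x) :
    ∃ M : ℝ, 0 ≤ M ∧ ∀ᶠ x in 𝓝 xb, ∃ lam : Fin q → ℝ, (∀ i, 0 ≤ lam i) ∧ (∀ i, lam i ≤ M) ∧
      ∀ y, Lag f g x y lam ≤ W x := by
  obtain ⟨κ, hκ, hκg⟩ : ∃ κ : ℝ, 0 < κ ∧ ∀ i, g xb y₀ i < -κ := by
    have h1 : ∀ᶠ κ in 𝓝[>] (0 : ℝ), ∀ i, g xb y₀ i < -κ :=
      Filter.eventually_all.2 fun i => ((continuous_const.continuousAt.eventually_lt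
        continuous_neg.continuousAt (by simpa using hy₀ i)).filter_mono nhdsWithin_le_nhds)
    obtain ⟨κ, h2, h3⟩ := (h1.and self_mem_nhdsWithin).exists
    exact ⟨κ, h3, h2⟩
  have hκe : ∀ᶠ x in 𝓝 xb, ∀ i, g x y₀ i < -κ := Filter.eventually_all.2 fun i =>
    ((hg i).comp (continuous_id.prodMk continuous_const)).continuousAt.eventually_lt
      continuousAt_const (hκg i)
  have hlow : ∀ᶠ x in 𝓝 xb, f xb y₀ - 1 < f x y₀ :=
    continuousAt_const.eventually_lt
      (hf.comp (continuous_id.prodMk continuous_const)).continuousAt (sub_one_lt _)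
  have hup : ∀ᶠ x in 𝓝 xb, W x < f xb yb + 1 := by
    have h1 : ∀ᶠ p : EuclideanSpace ℝ (Fin n) × EuclideanSpace ℝ (Fin m) in 𝓝 (xb, yb),
        f p.1 p.2 < f xb yb + 1 :=
      hf.continuousAt.eventually_lt continuousAt_const (lt_add_one _)
    obtain ⟨δ, hδ, hb⟩ := Metric.eventually_nhds_iff_ball.1 h1
    filter_upwards [ball_mem_nhds xb hδ, hW (δ / 2) (by positivity)] with x hx ⟨y, hy, _, hyW⟩
    rw [← hyW]
    refine hb (x, y) ?_
    rw [← ball_prod_same]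
    exact ⟨hx, (mem_closedBall.1 hy).trans_lt (half_lt_self hδ)⟩
  refine ⟨max 0 ((f xb yb + 1 - (f xb y₀ - 1)) / κ), le_max_left _ _, ?_⟩
  filter_upwards [hconv, hκe, hlow, hup, hle] with x hxc hxκ hxl hxu hxle
  obtain ⟨lam, hlam, hL⟩ := exists_multiplier_of_slater hxc.1 hxc.2
    (fun i => (hxκ i).trans (neg_lt_zero.2 hκ)) hxle
  refine ⟨lam, hlam, fun i => le_max_of_le_right ?_, hL⟩
  have h1 := hL y₀
  have h2 := Finset.single_le_sum (f := fun j => -(lam j * g x y₀ j)) (fun j _ =>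
    neg_nonneg.2 (mul_nonpos_of_nonneg_of_nonpos (hlam j) ((hxκ j).trans (neg_lt_zero.2 hκ)).le))
    (Finset.mem_univ i)
  rw [Finset.sum_neg_distrib] at h2
  have h3 := mul_le_mul_of_nonneg_left (hxκ i).le (hlam i)
  rw [le_div_iff₀ hκ]
  linarith

end Parametric

/-- A Fréchet subgradient is close to any approximate linear upper bound. -/
theorem norm_sub_le_of_mem_FSub {n : ℕ} {φ : EuclideanSpace ℝ (Fin n) → EReal}
    {W : EuclideanSpace ℝ (Fin n) → ℝ} {x v w : EuclideanSpace ℝ (Fin n)} {ε : ℝ} (hε : 0 < ε)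
    (hv : v ∈ FSub φ x) (hφ : ∀ᶠ x' in 𝓝 x, φ x' = (W x' : EReal))
    (hle : ∀ᶠ x' in 𝓝 x, W x' - W x ≤ ⟪w, x' - x⟫ + ε * ‖x' - x‖) : ‖v - w‖ ≤ 2 * ε := by
  obtain ⟨c, hc, hF⟩ := hv
  obtain ⟨δ, hδ, hF⟩ := hF ε hε
  have hcW : c = W x := by
    rw [hφ.self_of_nhds] at hc
    exact_mod_cast hc.symm
  have hlow : ∀ᶠ x' in 𝓝 x, W x + ⟪v, x' - x⟫ - ε * ‖x' - x‖ ≤ W x' := by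
    filter_upwards [ball_mem_nhds x hδ, hφ] with x' hx' hφx'
    have := hF x' (by rwa [← dist_eq_norm])
    rw [hφx', hcW] at this
    exact_mod_cast this
  have ht : Tendsto (fun t : ℝ => x + t • (v - w)) (𝓝[>] 0) (𝓝 x) := by
    have : Continuous fun t : ℝ => x + t • (v - w) := by fun_prop
    simpa using (this.tendsto 0).mono_left nhdsWithin_le_nhds
  obtain ⟨t, ⟨h1, h2⟩, ht0⟩ := ((ht.eventually (hlow.and hle)).and self_mem_nhdsWithin).exists
  have ht0 : 0 < t := ht0
  have h3 : t * (‖v - w‖ * ‖v - w‖) ≤ t * (2 * ε * ‖v - w‖) := by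
    rw [← real_inner_self_eq_norm_mul_norm, inner_sub_left]
    simp only [add_sub_cancel_left, inner_smul_right, norm_smul, Real.norm_eq_abs,
      abs_of_pos ht0] at h1 h2
    linarith
  rcases (norm_nonneg (v - w)).eq_or_lt with h0 | h0
  · rw [← h0]; positivity
  · exact le_of_mul_le_mul_right (le_of_mul_le_mul_left h3 ht0) h0

/-- Corollary 3.2 — MFCQ together with the second order sufficient condition. -/
theorem stmt3 {n m q : ℕ}
    (f : EuclideanSpace ℝ (Fin n) → EuclideanSpace ℝ (Fin m) → ℝ)
    (g : EuclideanSpace ℝ (Fin n) → EuclideanSpace ℝ (Fin m) → Fin q → ℝ)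
    (hf : ContDiff ℝ 2 (fun p : EuclideanSpace ℝ (Fin n) × EuclideanSpace ℝ (Fin m) => f p.1 p.2))
    (hg : ∀ i, ContDiff ℝ 2
      (fun p : EuclideanSpace ℝ (Fin n) × EuclideanSpace ℝ (Fin m) => g p.1 p.2 i))
    (xb : EuclideanSpace ℝ (Fin n)) (yb : EuclideanSpace ℝ (Fin m))
    (hyb : yb ∈ Sol f g xb)
    (hconv : ∃ δ : ℝ, 0 < δ ∧ ∀ x ∈ Metric.ball xb δ,
      ConcaveOn ℝ Set.univ (f x) ∧ ∀ i, ConvexOn ℝ Set.univ (fun y => g x y i))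
    (hmfcq : MFCQy g xb yb)
    (hsosc : ∀ lam ∈ SigmaSet f g xb yb, SOSC f g xb yb lam) :
    LipschitzNearAt (Vfun f g) xb ∧
    LSub (Vfun f g) xb ⊆ {v | ∃ lam ∈ SigmaSet f g xb yb, v = gradxL f g xb yb lam} := by
  have hconv' : ∀ᶠ x in 𝓝 xb, ConcaveOn ℝ Set.univ (f x) ∧
      ∀ i, ConvexOn ℝ Set.univ fun y => g x y i := by
    obtain ⟨δ, hδ, h⟩ := hconv
    exact Metric.eventually_nhds_iff_ball.2 ⟨δ, hδ, h⟩
  have hcb := hconv'.self_of_nhds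
  obtain ⟨hybf, hybV⟩ := hyb
  have hmaxb : ∀ y ∈ Feas g xb, f xb y ≤ f xb yb := fun y hy => by
    have : (f xb y : EReal) ≤ f xb yb := by
      rw [hybV]
      exact le_sSup ⟨y, hy, rfl⟩
    exact_mod_cast this
  obtain ⟨y₀, hy₀⟩ := hmfcq.exists_slater hg hcb.2 hybf
  have huniq : ∀ y ∈ Feas g xb, f xb yb ≤ f xb y → y = yb := fun y hy hle => by
    obtain ⟨lam, hlam, hL⟩ := exists_multiplier_of_slater hcb.1 hcb.2 hy₀ hmaxb
    exact SOSC.eq_of_le hf hg hcb.1 hcb.2 hybf hlam hL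
      (hsosc lam (mem_SigmaSet_of_forall_Lag_le hybf hlam hL)) hy hle
  have hsol : ∀ r : ℝ, 0 < r → ∀ᶠ x in 𝓝 xb, ∃ y ∈ closedBall yb r, y ∈ Feas g x ∧
      ∀ y' ∈ Feas g x, f x y' ≤ f x y := fun r hr =>
    eventually_exists_solution_mem_closedBall hf.continuous (fun i => (hg i).continuous) hconv'
      hy₀ hybf huniq hr
  set W : EuclideanSpace ℝ (Fin n) → ℝ := fun x => (Vfun f g x).toReal with hWdef
  have hVeq : ∀ {x y}, y ∈ Feas g x → (∀ y' ∈ Feas g x, f x y' ≤ f x y) →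
      Vfun f g x = (f x y : EReal) := fun {x y} hy hmax => by
    refine le_antisymm (sSup_le ?_) (le_sSup ⟨y, hy, rfl⟩)
    rintro _ ⟨y', hy', rfl⟩
    exact EReal.coe_le_coe_iff.2 (hmax y' hy')
  have hW : ∀ r : ℝ, 0 < r → ∀ᶠ x in 𝓝 xb, ∃ y ∈ closedBall yb r, y ∈ Feas g x ∧ f x y = W x :=
    fun r hr => (hsol r hr).mono fun x ⟨y, hyr, hy, hmax⟩ =>
      ⟨y, hyr, hy, by rw [hWdef]; simp only [hVeq hy hmax, EReal.toReal_coe]⟩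
  have hVW : ∀ᶠ x in 𝓝 xb, Vfun f g x = (W x : EReal) :=
    (hsol 1 one_pos).mono fun x ⟨y, _, hy, hmax⟩ => by
      rw [hWdef]; simp only [hVeq hy hmax, EReal.toReal_coe]
  have hWle : ∀ᶠ x in 𝓝 xb, ∀ y ∈ Feas g x, f x y ≤ W x :=
    (hsol 1 one_pos).mono fun x ⟨y, _, hy, hmax⟩ y' hy' => by
      rw [hWdef]; simp only [hVeq hy hmax, EReal.toReal_coe]; exact hmax y' hy'
  have hWb : W xb = f xb yb := by rw [hWdef]; simp only [← hybV, EReal.toReal_coe]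
  obtain ⟨M, hM, hmult⟩ := exists_bounded_multipliers hf.continuous
    (fun i => (hg i).continuous) hconv' hy₀ hW hWle
  have hest := fun {ε : ℝ} (hε : 0 < ε) => exists_forall_value_sub_le hf hg hW hM hε
  have hlip : LipschitzNearAt (Vfun f g) xb := by
    obtain ⟨δ, hδ, h⟩ := hest one_pos
    obtain ⟨δ', hδ', h'⟩ := Metric.eventually_nhds_iff_ball.1 (hmult.and hVW)
    set B : ℝ := ‖gradx f xb yb‖ + ∑ i, M * ‖gradx (fun x y => g x y i) xb yb‖ with hB
    have hB0 : 0 ≤ B := by positivity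
    have hL : LipschitzOnWith (B + 1).toNNReal W (ball xb (min δ δ')) := by
      refine LipschitzOnWith.of_le_add_mul _ fun x' hx' x hx => ?_
      obtain ⟨lam, hlam, hlamM, hlamL⟩ := (h' x (ball_subset_ball (min_le_right _ _) hx)).1
      have h1 := h x (ball_subset_ball (min_le_left _ _) hx) x'
        (ball_subset_ball (min_le_left _ _) hx') lam hlam hlamM hlamL
      have h2 : ‖gradxL f g xb yb lam‖ ≤ B := by
        rw [gradxL_eq hf hg]
        refine (norm_sub_le _ _).trans (add_le_add_right ?_ _)
        refine (norm_sum_le _ _).trans (Finset.sum_le_sum fun i _ => ?_)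
        rw [norm_smul, Real.norm_of_nonneg (hlam i)]
        exact mul_le_mul_of_nonneg_right (hlamM i) (norm_nonneg _)
      have h3 := (real_inner_le_norm (gradxL f g xb yb lam) (x' - x)).trans
        (mul_le_mul_of_nonneg_right h2 (norm_nonneg _))
      rw [Real.coe_toNNReal _ (by positivity), dist_eq_norm]
      linarith
    obtain ⟨ψ, hψ, heq⟩ := hL.extend_real
    exact ⟨min δ δ', lt_min hδ hδ', _, ψ, hψ, fun x hx => by
      rw [(h' x (ball_subset_ball (min_le_right _ _) hx)).2, heq hx]⟩
  refine ⟨hlip, ?_⟩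
  have hWcont : Tendsto W (𝓝 xb) (𝓝 (W xb)) := by
    obtain ⟨δ, hδ, K, ψ, hψ, h⟩ := hlip
    have h1 : W =ᶠ[𝓝 xb] ψ := Metric.eventually_nhds_iff_ball.2 ⟨δ, hδ, fun x hx => by
      rw [hWdef]; simp only [h x hx, EReal.toReal_coe]⟩
    rw [h1.eq_of_nhds]
    exact (hψ.continuous.tendsto xb).congr' h1.symm
  rintro v ⟨xk, vk, hF, hxk, -, hvk⟩
  have hchoose : ∀ k, ∃ lam ∈ Set.Icc (0 : Fin q → ℝ) fun _ => M,
      (∃ lam : Fin q → ℝ, (∀ i, 0 ≤ lam i) ∧ (∀ i, lam i ≤ M) ∧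
        ∀ y, Lag f g (xk k) y lam ≤ W (xk k)) → ∀ y, Lag f g (xk k) y lam ≤ W (xk k) := fun k => by
    by_cases hk : ∃ lam : Fin q → ℝ, (∀ i, 0 ≤ lam i) ∧ (∀ i, lam i ≤ M) ∧
        ∀ y, Lag f g (xk k) y lam ≤ W (xk k)
    · obtain ⟨lam, h1, h2, h3⟩ := hk
      exact ⟨lam, ⟨h1, h2⟩, fun _ => h3⟩
    · exact ⟨0, ⟨le_rfl, fun _ => hM⟩, fun h => absurd h hk⟩
  choose lamk hlamk hlamL using hchoose
  have hL : ∀ᶠ k in atTop, ∀ y, Lag f g (xk k) y (lamk k) ≤ W (xk k) :=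
    (hxk.eventually hmult).mono hlamL
  have hdiff : Tendsto (fun k => vk k - gradxL f g xb yb (lamk k)) atTop (𝓝 0) := by
    refine Metric.tendsto_nhds.2 fun ε hε => ?_
    obtain ⟨δ, hδ, h⟩ := hest (show 0 < ε / 4 by positivity)
    filter_upwards [hL, hxk.eventually (ball_mem_nhds xb hδ),
      hxk.eventually hVW.eventually_nhds] with k hk hkδ hkV
    have := norm_sub_le_of_mem_FSub (by positivity) (hF k) hkV
      ((isOpen_ball.eventually_mem hkδ).mono fun x' hx' =>
        h (xk k) hkδ x' hx' (lamk k) (hlamk k).1 (hlamk k).2 hk)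
    rw [dist_zero_right]
    linarith
  obtain ⟨lam, hlam, θ, hθ, hlim⟩ := isCompact_Icc.tendsto_subseq hlamk
  have hlimi := fun i => (tendsto_pi_nhds.1 hlim) i
  refine ⟨lam, mem_SigmaSet_of_forall_Lag_le hybf hlam.1 fun y => ?_, ?_⟩
  · rw [← hWb]
    refine le_of_tendsto_of_tendsto ?_ (hWcont.comp (hxk.comp hθ.tendsto_atTop))
      ((hθ.tendsto_atTop.eventually hL).mono fun k hk => hk y)
    have hpt : Tendsto (fun k => (xk (θ k), y)) atTop (𝓝 (xb, y)) :=
      (hxk.comp hθ.tendsto_atTop).prodMk_nhds tendsto_const_nhds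
    exact ((hf.continuous.tendsto (xb, y)).comp hpt).sub
      (tendsto_finsetSum _ fun i _ => (hlimi i).mul (((hg i).continuous.tendsto (xb, y)).comp hpt))
  · have hG : Tendsto (fun k => gradxL f g xb yb (lamk (θ k))) atTop
        (𝓝 (gradxL f g xb yb lam)) := by
      simp only [gradxL_eq hf hg]
      exact tendsto_const_nhds.sub
        (tendsto_finsetSum _ fun i _ => (hlimi i).smul tendsto_const_nhds)
    have h1 := (hdiff.comp hθ.tendsto_atTop).add hG
    rw [zero_add] at h1
    refine tendsto_nhds_unique (hvk.comp hθ.tendsto_atTop) (h1.congr fun k => ?_)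
    simp
end

section
/- Assume ȳ ∈ S(x̄), f is jointly concave on ℝⁿ×ℝᵐ, and each g_i is jointly quasiconvex in (x,y). Suppose there is an open set O containing x̄ such that for every x ∈ O, F(x) ≠ ∅ and f(x,·) is bounded above on F(x). Assume a CQ holds for the system g(x,y) ≤ 0 (in the joint variable (x,y)) at (x̄,ȳ). Then V is concave, Lipschitz continuous near x̄, and ∂V(x̄) ⊆ {∇_x L(x̄,ȳ,λ) : λ ∈ Σ(x̄,ȳ)}. -/
open Filter Topology Metric RealInnerProductSpace

lemma le_Vfun {n m q : ℕ} {f : EuclideanSpace ℝ (Fin n) → EuclideanSpace ℝ (Fin m) → ℝ}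
    {g : EuclideanSpace ℝ (Fin n) → EuclideanSpace ℝ (Fin m) → Fin q → ℝ}
    {x : EuclideanSpace ℝ (Fin n)} {y : EuclideanSpace ℝ (Fin m)} (hy : y ∈ Feas g x) :
    (f x y : EReal) ≤ Vfun f g x :=
  le_sSup ⟨y, hy, rfl⟩

lemma exists_lt_of_lt_mul_Vfun {n m q : ℕ}
    {f : EuclideanSpace ℝ (Fin n) → EuclideanSpace ℝ (Fin m) → ℝ}
    {g : EuclideanSpace ℝ (Fin n) → EuclideanSpace ℝ (Fin m) → Fin q → ℝ}
    {x : EuclideanSpace ℝ (Fin n)} {a : ℝ} (ha : 0 < a) {c : EReal}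
    (hc : c < (a : EReal) * Vfun f g x) :
    ∃ y ∈ Feas g x, c < ((a * f x y : ℝ) : EReal) := by
  contrapose! hc
  rw [mul_comm, ← EReal.le_div_iff_mul_le (by exact_mod_cast ha) (EReal.coe_ne_top a)]
  refine sSup_le ?_
  rintro _ ⟨y, hy, rfl⟩
  rw [EReal.le_div_iff_mul_le (by exact_mod_cast ha) (EReal.coe_ne_top a), mul_comm]
  simpa using hc y hy

/-- The value function of a jointly concave program with jointly quasiconvex constraints is
concave. -/
lemma Vfun_concave {n m q : ℕ}
    {f : EuclideanSpace ℝ (Fin n) → EuclideanSpace ℝ (Fin m) → ℝ}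
    {g : EuclideanSpace ℝ (Fin n) → EuclideanSpace ℝ (Fin m) → Fin q → ℝ}
    (hconc : ConcaveOn ℝ Set.univ
      (fun p : EuclideanSpace ℝ (Fin n) × EuclideanSpace ℝ (Fin m) => f p.1 p.2))
    (hquasi : ∀ i, QuasiconvexOn ℝ Set.univ
      (fun p : EuclideanSpace ℝ (Fin n) × EuclideanSpace ℝ (Fin m) => g p.1 p.2 i))
    (x₁ x₂ : EuclideanSpace ℝ (Fin n)) {a b : ℝ} (ha : 0 ≤ a) (hb : 0 ≤ b) (hab : a + b = 1) :
    (a : EReal) * Vfun f g x₁ + (b : EReal) * Vfun f g x₂ ≤ Vfun f g (a • x₁ + b • x₂) := by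
  rcases ha.eq_or_lt with rfl | ha'
  · obtain rfl : b = 1 := by linarith
    simp
  rcases hb.eq_or_lt with rfl | hb'
  · obtain rfl : a = 1 := by linarith
    simp
  refine EReal.add_le_of_forall_lt fun c hc d hd => ?_
  obtain ⟨y₁, hy₁, hc⟩ := exists_lt_of_lt_mul_Vfun ha' hc
  obtain ⟨y₂, hy₂, hd⟩ := exists_lt_of_lt_mul_Vfun hb' hd
  have hy : a • y₁ + b • y₂ ∈ Feas g (a • x₁ + b • x₂) := fun i =>
    (hquasi i 0 (x := (x₁, y₁)) ⟨trivial, hy₁ i⟩ (y := (x₂, y₂)) ⟨trivial, hy₂ i⟩ ha hb hab).2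
  have hf : a * f x₁ y₁ + b * f x₂ y₂ ≤ f (a • x₁ + b • x₂) (a • y₁ + b • y₂) :=
    hconc.2 (x := (x₁, y₁)) trivial (y := (x₂, y₂)) trivial ha hb hab
  calc c + d ≤ ((a * f x₁ y₁ : ℝ) : EReal) + ((b * f x₂ y₂ : ℝ) : EReal) := add_le_add hc.le hd.le
    _ ≤ (f (a • x₁ + b • x₂) (a • y₁ + b • y₂) : EReal) := by exact_mod_cast hf
    _ ≤ _ := le_Vfun hy

lemma exists_Vfun_eq_coe {n m q : ℕ}
    {f : EuclideanSpace ℝ (Fin n) → EuclideanSpace ℝ (Fin m) → ℝ}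
    {g : EuclideanSpace ℝ (Fin n) → EuclideanSpace ℝ (Fin m) → Fin q → ℝ}
    {x : EuclideanSpace ℝ (Fin n)} (hne : (Feas g x).Nonempty)
    (hbdd : BddAbove (f x '' Feas g x)) :
    ∃ c : ℝ, Vfun f g x = c := by
  obtain ⟨y, hy⟩ := hne
  obtain ⟨M, hM⟩ := hbdd
  have hle : Vfun f g x ≤ (M : EReal) := by
    refine sSup_le ?_
    rintro _ ⟨z, hz, rfl⟩
    exact EReal.coe_le_coe_iff.2 (hM ⟨z, hz, rfl⟩)
  exact ⟨_, (EReal.coe_toReal (ne_top_of_le_ne_top (EReal.coe_ne_top M) hle)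
    (ne_bot_of_le_ne_bot (EReal.coe_ne_bot _) (le_Vfun hy))).symm⟩

/-- A Fréchet subgradient of a concave function is a supergradient. -/
lemma ConcaveOn.le_add_inner_of_frechet_subgradient {E : Type*} [NormedAddCommGroup E]
    [InnerProductSpace ℝ E] {s : Set E} {ψ : E → ℝ} (hψ : ConcaveOn ℝ s ψ) (hs : IsOpen s)
    {x₀ v : E} (hx₀ : x₀ ∈ s)
    (hv : ∀ ε : ℝ, 0 < ε → ∀ᶠ x in 𝓝 x₀, ψ x₀ + ⟪v, x - x₀⟫ - ε * ‖x - x₀‖ ≤ ψ x)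
    {x : E} (hx : x ∈ s) : ψ x ≤ ψ x₀ + ⟪v, x - x₀⟫ := by
  have key : ∀ ε : ℝ, 0 < ε → ψ x ≤ ψ x₀ + ⟪v, x - x₀⟫ + ε * ‖x - x₀‖ := by
    intro ε hε
    have hlim : Tendsto (fun t : ℝ => x₀ - t • (x - x₀)) (𝓝[>] 0) (𝓝 x₀) := by
      have : Continuous fun t : ℝ => x₀ - t • (x - x₀) := by fun_prop
      simpa using (this.tendsto 0).mono_left nhdsWithin_le_nhds
    obtain ⟨t, ⟨hvt, hst⟩, ht⟩ := ((hlim.eventually ((hv ε hε).and (hs.mem_nhds hx₀))).and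
      self_mem_nhdsWithin).exists
    have ht : 0 < t := ht
    have hc := hψ.2 hst hx (show 0 ≤ 1 / (1 + t) by positivity)
      (show 0 ≤ t / (1 + t) by positivity) (by field_simp)
    have heq : (1 / (1 + t)) • (x₀ - t • (x - x₀)) + (t / (1 + t)) • x = x₀ := by
      match_scalars <;> field_simp <;> ring
    rw [heq, smul_eq_mul, smul_eq_mul] at hc
    have hc' : ψ (x₀ - t • (x - x₀)) + t * ψ x ≤ (1 + t) * ψ x₀ := by
      calc ψ (x₀ - t • (x - x₀)) + t * ψ x
          = (1 + t) * (1 / (1 + t) * ψ (x₀ - t • (x - x₀)) + t / (1 + t) * ψ x) := by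
            generalize ψ (x₀ - t • (x - x₀)) = u
            field_simp
        _ ≤ (1 + t) * ψ x₀ := mul_le_mul_of_nonneg_left hc (by positivity)
    have hd : x₀ - t • (x - x₀) - x₀ = -(t • (x - x₀)) := by abel
    rw [hd, inner_neg_right, real_inner_smul_right, norm_neg, norm_smul, Real.norm_of_nonneg ht.le]
      at hvt
    have : t * ψ x ≤ t * (ψ x₀ + ⟪v, x - x₀⟫ + ε * ‖x - x₀‖) := by nlinarith
    exact le_of_mul_le_mul_left this ht
  have hlim : Tendsto (fun ε : ℝ => ψ x₀ + ⟪v, x - x₀⟫ + ε * ‖x - x₀‖) (𝓝[>] 0)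
      (𝓝 (ψ x₀ + ⟪v, x - x₀⟫)) := by
    have : Continuous fun ε : ℝ => ψ x₀ + ⟪v, x - x₀⟫ + ε * ‖x - x₀‖ := by fun_prop
    simpa using (this.tendsto 0).mono_left nhdsWithin_le_nhds
  exact ge_of_tendsto hlim (by filter_upwards [self_mem_nhdsWithin] with ε hε using key ε hε)

/-- A limiting subgradient of a function that is finite and concave on an open set is a
supergradient. -/
lemma le_add_inner_of_mem_LSub {n : ℕ} {φ : EuclideanSpace ℝ (Fin n) → EReal}
    {ψ : EuclideanSpace ℝ (Fin n) → ℝ} {s : Set (EuclideanSpace ℝ (Fin n))}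
    (hs : IsOpen s) (hψ : ConcaveOn ℝ s ψ) (hφ : ∀ x ∈ s, φ x = ψ x)
    {x₀ v : EuclideanSpace ℝ (Fin n)} (hx₀ : x₀ ∈ s) (hv : v ∈ LSub φ x₀)
    {x : EuclideanSpace ℝ (Fin n)} (hx : x ∈ s) : ψ x ≤ ψ x₀ + ⟪v, x - x₀⟫ := by
  obtain ⟨xk, vk, hsub, hxk, hφk, hvk⟩ := hv
  have hmem : ∀ᶠ k in atTop, xk k ∈ s := hxk.eventually (hs.mem_nhds hx₀)
  have hψk : Tendsto (fun k => ψ (xk k)) atTop (𝓝 (ψ x₀)) :=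
    ((hψ.continuousOn hs).continuousAt (hs.mem_nhds hx₀)).tendsto.comp hxk
  refine ge_of_tendsto (hψk.add (hvk.inner (tendsto_const_nhds.sub hxk))) ?_
  filter_upwards [hmem] with k hk
  refine hψ.le_add_inner_of_frechet_subgradient hs hk (fun ε hε => ?_) hx
  obtain ⟨c, hc, hsubk⟩ := hsub k
  obtain ⟨δ, hδ, hle⟩ := hsubk ε hε
  obtain rfl : ψ (xk k) = c := EReal.coe_injective ((hφ _ hk).symm.trans hc)
  filter_upwards [Metric.ball_mem_nhds (xk k) hδ, hs.mem_nhds hk] with z hz hzs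
  have := hle z (by simpa [dist_eq_norm] using hz)
  rw [hφ z hzs] at this
  exact_mod_cast this

/-- A supergradient of the value function yields KKT multipliers at a solution where a constraint
qualification holds. -/
lemma exists_multiplier_of_supergradient {n m q : ℕ}
    {f : EuclideanSpace ℝ (Fin n) → EuclideanSpace ℝ (Fin m) → ℝ}
    {g : EuclideanSpace ℝ (Fin n) → EuclideanSpace ℝ (Fin m) → Fin q → ℝ}
    (hf : ContDiff ℝ 1 (fun p : EuclideanSpace ℝ (Fin n) × EuclideanSpace ℝ (Fin m) => f p.1 p.2))
    (hg : ∀ i, ContDiff ℝ 1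
      (fun p : EuclideanSpace ℝ (Fin n) × EuclideanSpace ℝ (Fin m) => g p.1 p.2 i))
    {xb : EuclideanSpace ℝ (Fin n)} {yb : EuclideanSpace ℝ (Fin m)} (hyb : yb ∈ Feas g xb)
    (hcq : CQAt (fun (w : EuclideanSpace ℝ (Fin n) × EuclideanSpace ℝ (Fin m)) i => g w.1 w.2 i)
      (fun _ : EuclideanSpace ℝ (Fin n) × EuclideanSpace ℝ (Fin m) => (fun _ : Fin 0 => (0 : ℝ)))
      (xb, yb))
    {v : EuclideanSpace ℝ (Fin n)}
    (hv : ∀ᶠ x in 𝓝 xb, ∀ y ∈ Feas g x, f x y ≤ f xb yb + ⟪v, x - xb⟫) :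
    ∃ lam ∈ SigmaSet f g xb yb, v = gradxL f g xb yb lam := by
  let θ : EuclideanSpace ℝ (Fin n) × EuclideanSpace ℝ (Fin m) → ℝ :=
    fun p => (innerSL ℝ v).comp (ContinuousLinearMap.fst ℝ _ _) p - f p.1 p.2
  have hθ : ContDiff ℝ 1 θ := (ContinuousLinearMap.contDiff _).sub hf
  have hmin : IsLocalMinOn θ {w : EuclideanSpace ℝ (Fin n) × EuclideanSpace ℝ (Fin m) |
      (∀ i, g w.1 w.2 i ≤ 0) ∧ ∀ _ : Fin 0, (0 : ℝ) = 0} (xb, yb) := by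
    have hev : ∀ᶠ p : EuclideanSpace ℝ (Fin n) × EuclideanSpace ℝ (Fin m) in 𝓝 (xb, yb),
        ∀ y ∈ Feas g p.1, f p.1 y ≤ f xb yb + ⟪v, p.1 - xb⟫ :=
      (continuous_fst.tendsto (xb, yb)).eventually hv
    filter_upwards [hev.filter_mono nhdsWithin_le_nhds, self_mem_nhdsWithin] with p hp hfeas
    have := hp p.2 hfeas.1
    rw [inner_sub_right] at this
    change ⟪v, xb⟫ - f xb yb ≤ ⟪v, p.1⟫ - f p.1 p.2
    linarith
  obtain ⟨lam, mu, hlam, hkkt, hcompl⟩ := hcq θ hθ hmin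
  have hfd := (hf.differentiable one_ne_zero (xb, yb)).hasFDerivAt
  have hgd := fun i => (hg i |>.differentiable one_ne_zero (xb, yb)).hasFDerivAt
  have hθd := (((innerSL ℝ v).comp (ContinuousLinearMap.fst ℝ (EuclideanSpace ℝ (Fin n))
    (EuclideanSpace ℝ (Fin m)))).hasFDerivAt (x := (xb, yb))).sub hfd
  have hL : HasFDerivAt
      (fun p : EuclideanSpace ℝ (Fin n) × EuclideanSpace ℝ (Fin m) => Lag f g p.1 p.2 lam)
      ((innerSL ℝ v).comp (ContinuousLinearMap.fst ℝ (EuclideanSpace ℝ (Fin n))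
        (EuclideanSpace ℝ (Fin m)))) (xb, yb) := by
    have h := hfd.sub (HasFDerivAt.fun_sum fun i (_ : i ∈ Finset.univ) =>
      (hgd i).const_mul (lam i))
    refine h.congr_fderiv ?_
    rw [show fderiv ℝ θ (xb, yb) = _ from hθd.fderiv, Finset.univ_eq_empty (α := Fin 0),
      Finset.sum_empty,
      add_zero] at hkkt
    rw [← sub_eq_zero, ← neg_eq_zero, ← hkkt]
    abel
  have hLx : HasGradientAt (fun x => Lag f g x yb lam) v xb := by
    rw [hasGradientAt_iff_hasFDerivAt]
    exact (HasFDerivAt.comp (f := fun x => (x, yb)) xb hL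
      (hasFDerivAt_prodMk_left (𝕜 := ℝ) xb yb)).congr_fderiv (by ext; simp)
  have hLy : HasGradientAt (fun y => Lag f g xb y lam) 0 yb := by
    rw [hasGradientAt_iff_hasFDerivAt]
    exact (HasFDerivAt.comp (f := fun y => (xb, y)) yb hL
      (hasFDerivAt_prodMk_right (𝕜 := ℝ) xb yb)).congr_fderiv (by ext; simp)
  exact ⟨lam, ⟨hLy.gradient, hlam, hyb, hcompl⟩, hLx.gradient.symm⟩

/-- Theorem 3.2 — joint concavity/quasiconvexity case. -/
theorem stmt4 {n m q : ℕ}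
    (f : EuclideanSpace ℝ (Fin n) → EuclideanSpace ℝ (Fin m) → ℝ)
    (g : EuclideanSpace ℝ (Fin n) → EuclideanSpace ℝ (Fin m) → Fin q → ℝ)
    (hf : ContDiff ℝ 1 (fun p : EuclideanSpace ℝ (Fin n) × EuclideanSpace ℝ (Fin m) => f p.1 p.2))
    (hg : ∀ i, ContDiff ℝ 1
      (fun p : EuclideanSpace ℝ (Fin n) × EuclideanSpace ℝ (Fin m) => g p.1 p.2 i))
    (xb : EuclideanSpace ℝ (Fin n)) (yb : EuclideanSpace ℝ (Fin m))
    (hyb : yb ∈ Sol f g xb)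
    (hconc : ConcaveOn ℝ Set.univ
      (fun p : EuclideanSpace ℝ (Fin n) × EuclideanSpace ℝ (Fin m) => f p.1 p.2))
    (hquasi : ∀ i, QuasiconvexOn ℝ Set.univ
      (fun p : EuclideanSpace ℝ (Fin n) × EuclideanSpace ℝ (Fin m) => g p.1 p.2 i))
    (O : Set (EuclideanSpace ℝ (Fin n))) (hO : IsOpen O) (hxbO : xb ∈ O)
    (hbdd : ∀ x ∈ O, (Feas g x).Nonempty ∧ BddAbove (f x '' Feas g x))
    (hcq : CQAt (fun (w : EuclideanSpace ℝ (Fin n) × EuclideanSpace ℝ (Fin m)) i => g w.1 w.2 i)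
      (fun _ : EuclideanSpace ℝ (Fin n) × EuclideanSpace ℝ (Fin m) => (fun _ : Fin 0 => (0 : ℝ)))
      (xb, yb)) :
    (∀ (x₁ x₂ : EuclideanSpace ℝ (Fin n)) (a b : ℝ), 0 ≤ a → 0 ≤ b → a + b = 1 →
      (a : EReal) * Vfun f g x₁ + (b : EReal) * Vfun f g x₂ ≤ Vfun f g (a • x₁ + b • x₂)) ∧
    LipschitzNearAt (Vfun f g) xb ∧
    LSub (Vfun f g) xb ⊆ {v | ∃ lam ∈ SigmaSet f g xb yb, v = gradxL f g xb yb lam} := by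
  have hVconc := fun x₁ x₂ (a b : ℝ) (ha : 0 ≤ a) (hb : 0 ≤ b) (hab : a + b = 1) =>
    Vfun_concave hconc hquasi x₁ x₂ ha hb hab
  obtain ⟨r, hr, hball⟩ := Metric.isOpen_iff.1 hO xb hxbO
  let ψ : EuclideanSpace ℝ (Fin n) → ℝ := fun x => (Vfun f g x).toReal
  have hψ : ∀ x ∈ ball xb r, Vfun f g x = ψ x := fun x hx => by
    obtain ⟨c, hc⟩ := exists_Vfun_eq_coe (hbdd x (hball hx)).1 (hbdd x (hball hx)).2
    simp [ψ, hc]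
  have hψconc : ConcaveOn ℝ (ball xb r) ψ := by
    refine ⟨convex_ball xb r, fun x₁ hx₁ x₂ hx₂ a b ha hb hab => ?_⟩
    have h := hVconc x₁ x₂ a b ha hb hab
    rw [hψ x₁ hx₁, hψ x₂ hx₂, hψ _ (convex_ball xb r hx₁ hx₂ ha hb hab)] at h
    exact_mod_cast h
  refine ⟨hVconc, ?_, fun v hv => ?_⟩
  · obtain ⟨K, t, ht, hK⟩ := hψconc.locallyLipschitzOn isOpen_ball (mem_ball_self hr)
    rw [isOpen_ball.nhdsWithin_eq (mem_ball_self hr)] at ht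
    obtain ⟨δ, hδ, hδt⟩ := Metric.mem_nhds_iff.1 (inter_mem ht (ball_mem_nhds xb hr))
    obtain ⟨ψ', hψ'K, heq⟩ := hK.extend_real
    refine ⟨δ, hδ, K, ψ', hψ'K, fun x hx => ?_⟩
    rw [hψ x (hδt hx).2, heq (hδt hx).1]
  · refine exists_multiplier_of_supergradient hf hg hyb.1 hcq ?_
    filter_upwards [ball_mem_nhds xb hr] with x hx y hy
    have hψxb : f xb yb = ψ xb :=
      EReal.coe_injective (hyb.2.trans (hψ xb (mem_ball_self hr)))
    have hle : f x y ≤ ψ x := EReal.coe_le_coe_iff.1 ((le_Vfun hy).trans_eq (hψ x hx))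
    rw [hψxb]
    exact hle.trans (le_add_inner_of_mem_LSub isOpen_ball hψconc hψ (mem_ball_self hr) hv hx)
end

section
/- Assume f, g are twice continuously differentiable and −f(x,·), g_i(x,·) are convex on ℝᵐ for all x near x̄. Let ȳ ∈ S(x̄) and λ̄ ∈ Σ(x̄,ȳ), and suppose a CQ holds at (x̄,ȳ,λ̄) for the constraint system {(x,y,λ) ∈ ℝⁿ×ℝᵐ×ℝ^q : ∇_y L(x,y,λ) = 0, λ ≥ 0}. Then ∂̂V(x̄) ⊆ {∇_x L(x̄,ȳ,λ̄) + ∇²_{xy}L(x̄,ȳ,λ̄)u : u ∈ Ξ¹(x̄,ȳ,λ̄)}. -/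
open Filter Topology Metric RealInnerProductSpace

/-- If a property `P ε` holds near `0` for every `ε > 0`, there is a `C¹` function, vanishing at `0`
together with its derivative, which near `0` dominates `ε‖x‖` for some `ε` with `P ε x`. -/
theorem exists_contDiff_majorant {E : Type*} [NormedAddCommGroup E] [InnerProductSpace ℝ E]
    {P : ℝ → E → Prop} (h : ∀ ε : ℝ, 0 < ε → ∃ δ : ℝ, 0 < δ ∧ ∀ x, ‖x‖ < δ → P ε x) :
    ∃ φ : E → ℝ, ContDiff ℝ 1 φ ∧ φ 0 = 0 ∧ fderiv ℝ φ 0 = 0 ∧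
      ∀ᶠ x in 𝓝 (0 : E), ∃ ε : ℝ, P ε x ∧ ε * ‖x‖ ≤ φ x := by
  have hpow (k : ℕ) : (0 : ℝ) < (1 / 2) ^ k := by positivity
  choose δ' hδ'pos hδ'P using fun k : ℕ => h ((1 / 2) ^ k) (hpow k)
  let δ : ℕ → ℝ := fun k => min (δ' k) ((1 / 2) ^ k)
  have hδpos (k : ℕ) : 0 < δ k := lt_min (hδ'pos k) (hpow k)
  have hδP (k : ℕ) (x : E) (hx : ‖x‖ < δ k) : P ((1 / 2) ^ k) x :=
    hδ'P k x (hx.trans_le (min_le_left _ _))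
  let r : ℕ → E → ℝ := fun k x => √(δ k ^ 2 + 3 * ‖x‖ ^ 2)
  have hrpos (k : ℕ) (x : E) : 0 < r k x :=
    Real.sqrt_pos.2 (by have := hδpos k; positivity)
  have hrsq (k : ℕ) (x : E) : r k x ^ 2 = δ k ^ 2 + 3 * ‖x‖ ^ 2 :=
    Real.sq_sqrt (by positivity)
  let F : ℕ → E → ℝ := fun k x => (2 * (1 / 2) ^ k) * (r k x - δ k)
  let F' : ℕ → E → E →L[ℝ] ℝ := fun k x => (2 * (1 / 2) ^ k * (3 / r k x)) • innerSL ℝ x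
  have hF0 (k : ℕ) : F k 0 = 0 := by
    simp [F, r, Real.sqrt_sq (hδpos k).le]
  have hFnn (k : ℕ) (x : E) : 0 ≤ F k x := by
    have : δ k ≤ r k x := by
      have := hrsq k x
      nlinarith [hrpos k x, hδpos k, sq_nonneg ‖x‖]
    have := hpow k
    exact mul_nonneg (by positivity) (by linarith)
  have hFderiv (k : ℕ) (x : E) : HasFDerivAt (F k) (F' k x) x := by
    have h1 : HasFDerivAt (fun x : E => δ k ^ 2 + 3 * ‖x‖ ^ 2)
        ((3 : ℝ) • (2 • innerSL ℝ x)) x :=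
      ((hasStrictFDerivAt_norm_sq x).hasFDerivAt.const_mul 3).const_add _
    have h2 := ((h1.sqrt (by have := hδpos k; positivity)).sub_const (δ k)).const_mul
      (2 * (1 / 2) ^ k)
    convert! h2 using 1
    have hr : √(δ k ^ 2 + 3 * ‖x‖ ^ 2) ≠ 0 := (hrpos k x).ne'
    ext z
    simp only [F', r, smul_apply, smul_eq_mul, nsmul_eq_mul]
    field_simp
    push_cast
    ring
  have hF'cont (k : ℕ) : Continuous (F' k) := by
    have : Continuous (r k) := by fun_prop
    exact (continuous_const.mul (continuous_const.div this fun x => (hrpos k x).ne')).smul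
      (innerSL ℝ).continuous
  have hF'bound (k : ℕ) (x : E) : ‖F' k x‖ ≤ 6 * (1 / 2) ^ k := by
    have h1 : ‖x‖ / r k x ≤ 1 := by
      rw [div_le_one (hrpos k x)]
      nlinarith [hrsq k x, hrpos k x, norm_nonneg x, sq_nonneg (δ k)]
    have h2 : ‖F' k x‖ = 6 * (1 / 2) ^ k * (‖x‖ / r k x) := by
      have := hrpos k x
      rw [norm_smul, innerSL_apply_norm, Real.norm_of_nonneg (by positivity)]
      ring
    rw [h2]
    exact mul_le_of_le_one_right (by positivity) h1
  have hsum : Summable fun k : ℕ => (6 : ℝ) * (1 / 2) ^ k := summable_geometric_two.mul_left 6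
  have hsum0 : Summable fun k => F k (0 : E) := by simp [hF0, summable_zero]
  have hφ := hasFDerivAt_tsum hsum hFderiv hF'bound hsum0
  have hφ0 : ∑' k, F k (0 : E) = 0 := by simp [hF0]
  refine ⟨fun x => ∑' k, F k x, ?_, hφ0, ?_, ?_⟩
  · refine contDiff_one_iff_fderiv.2 ⟨fun x => (hφ x).differentiableAt, ?_⟩
    rw [funext fun x => (hφ x).fderiv]
    exact continuous_tsum hF'cont hsum hF'bound
  · rw [(hφ 0).fderiv]
    simp [F']
  · filter_upwards [Metric.ball_mem_nhds (0 : E) (hδpos 0)] with x hx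
    rw [mem_ball_zero_iff] at hx
    have hsumx : Summable fun k => F k x :=
      summable_of_summable_hasFDerivAt hsum hFderiv hF'bound hsum0 x
    rcases (norm_nonneg x).eq_or_lt with h0 | h0
    · exact ⟨_, hδP 0 x hx, by rw [← h0, mul_zero]; exact tsum_nonneg fun k => hFnn k x⟩
    have hex : ∃ k, δ k ≤ ‖x‖ := by
      obtain ⟨k, hk⟩ := exists_pow_lt_of_lt_one h0 (by norm_num : (1 / 2 : ℝ) < 1)
      exact ⟨k, (min_le_right _ _).trans hk.le⟩
    obtain ⟨k, hk, hmin⟩ : ∃ k, δ (k + 1) ≤ ‖x‖ ∧ ‖x‖ < δ k := by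
      classical
      have hne : Nat.find hex ≠ 0 := fun h => by
        have := Nat.find_spec hex
        rw [h] at this
        linarith
      obtain ⟨k, hk⟩ := Nat.exists_eq_succ_of_ne_zero hne
      have hspec := Nat.find_spec hex
      rw [hk] at hspec
      exact ⟨k, hspec, not_le.1 (Nat.find_min hex (by omega))⟩
    refine ⟨_, hδP k x hmin, le_trans ?_ (hsumx.le_tsum (k + 1) fun j _ => hFnn j x)⟩
    have h1 : ‖x‖ ≤ r (k + 1) x - δ (k + 1) := by
      have h2 := hrsq (k + 1) x
      have h3 := hδpos (k + 1)
      nlinarith [hrpos (k + 1) x, mul_le_mul_of_nonneg_right hk h0.le]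
    have h4 : F (k + 1) x = (1 / 2) ^ k * (r (k + 1) x - δ (k + 1)) := by
      simp only [F, pow_succ]
      ring
    rw [h4]
    exact mul_le_mul_of_nonneg_left h1 (hpow k).le

/-- A differentiable concave function attains its maximum at every critical point. -/
theorem ConcaveOn.le_of_fderiv_eq_zero {E : Type*} [NormedAddCommGroup E] [NormedSpace ℝ E]
    {φ : E → ℝ} (hφ : ConcaveOn ℝ Set.univ φ) {y : E} (hd : HasFDerivAt φ (0 : E →L[ℝ] ℝ) y)
    (z : E) : φ z ≤ φ y := by
  have hc : ConcaveOn ℝ Set.univ (φ ∘ AffineMap.lineMap y z) :=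
    hφ.comp_affineMap (AffineMap.lineMap y z : ℝ →ᵃ[ℝ] E)
  have hy : HasFDerivAt φ (0 : E →L[ℝ] ℝ) (AffineMap.lineMap y z (0 : ℝ)) := by simpa using hd
  have hder : HasDerivAt (φ ∘ AffineMap.lineMap y z) 0 (0 : ℝ) := by
    simpa using hy.comp_hasDerivAt (0 : ℝ) AffineMap.hasDerivAt_lineMap
  have := hc.slope_le_of_hasDerivAt (Set.mem_univ 0) (Set.mem_univ 1) zero_lt_one hder
  simpa [slope_def_field] using this

theorem inner_gradient_comp {E W : Type*} [NormedAddCommGroup E] [InnerProductSpace ℝ E]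
    [CompleteSpace E] [NormedAddCommGroup W] [NormedSpace ℝ W] {T : W → ℝ} {ι : E → W}
    {ι' : E →L[ℝ] W} {x : E} (hT : DifferentiableAt ℝ T (ι x)) (hι : HasFDerivAt ι ι' x) (d : E) :
    ⟪gradient (fun x' => T (ι x')) x, d⟫ = fderiv ℝ T (ι x) (ι' d) := by
  have h : HasFDerivAt (fun x' => T (ι x')) ((fderiv ℝ T (ι x)).comp ι') x :=
    hT.hasFDerivAt.comp x hι
  rw [gradient, h.fderiv, InnerProductSpace.toDual_symm_apply, ContinuousLinearMap.comp_apply]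

theorem fderiv_apply_of_eq_add_mul {W : Type*} [NormedAddCommGroup W] [NormedSpace ℝ W]
    {T : W → ℝ} {w d : W} {a : ℝ} (hT : DifferentiableAt ℝ T w)
    (h : ∀ t : ℝ, T (w + t • d) = T w + t * a) : fderiv ℝ T w d = a := by
  have h1 : HasDerivAt (fun t : ℝ => T (w + t • d)) (fderiv ℝ T w d) 0 :=
    hT.hasFDerivAt.hasLineDerivAt d
  have h2 : HasDerivAt (fun t : ℝ => T w + t * a) a 0 := by
    simpa using ((hasDerivAt_id (0 : ℝ)).mul_const a).const_add (T w)
  rw [funext h] at h1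
  exact h1.unique h2

section PartialGradient

variable {n m : ℕ} {F : EuclideanSpace ℝ (Fin n) → EuclideanSpace ℝ (Fin m) → ℝ}

theorem contDiff_grady
    (hF : ContDiff ℝ 2 fun p : EuclideanSpace ℝ (Fin n) × EuclideanSpace ℝ (Fin m) => F p.1 p.2) :
    ContDiff ℝ 1 fun p : EuclideanSpace ℝ (Fin n) × EuclideanSpace ℝ (Fin m) =>
      grady F p.1 p.2 := by
  have h1 : ContDiff ℝ 1 (fderiv ℝ
      fun p : EuclideanSpace ℝ (Fin n) × EuclideanSpace ℝ (Fin m) => F p.1 p.2) :=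
    hF.fderiv_right (by norm_num)
  have h2 := (InnerProductSpace.toDual ℝ (EuclideanSpace ℝ (Fin m))).symm.contDiff.comp
    (h1.clm_comp (contDiff_const (c := ContinuousLinearMap.inr ℝ (EuclideanSpace ℝ (Fin n))
      (EuclideanSpace ℝ (Fin m)))))
  convert h2 using 2 with p
  have hd := (hF.differentiable (by norm_num) (p.1, p.2)).hasFDerivAt.comp p.2
    (hasFDerivAt_prodMk_right p.1 p.2)
  exact congrArg (InnerProductSpace.toDual ℝ (EuclideanSpace ℝ (Fin m))).symm hd.fderiv

end PartialGradient

/-- The space of triples `(x, y, λ)`. -/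
abbrev PrimalDualSpace (n m q : ℕ) : Type :=
  EuclideanSpace ℝ (Fin n) × EuclideanSpace ℝ (Fin m) × (Fin q → ℝ)

section Lagrangian

variable {n m q : ℕ}
  {f : EuclideanSpace ℝ (Fin n) → EuclideanSpace ℝ (Fin m) → ℝ}
  {g : EuclideanSpace ℝ (Fin n) → EuclideanSpace ℝ (Fin m) → Fin q → ℝ}

theorem sum_add_smul_single_smul {M : Type*} [AddCommGroup M] [Module ℝ M] (lam : Fin q → ℝ)
    (t : ℝ) (i : Fin q) (G : Fin q → M) :
    ∑ j, (lam + t • Pi.single i 1 : Fin q → ℝ) j • G j = ∑ j, lam j • G j + t • G i := by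
  simp [add_smul, Finset.sum_add_distrib, Pi.single_apply, ite_smul]

theorem contDiff_lag
    (hf : ContDiff ℝ 2 fun p : EuclideanSpace ℝ (Fin n) × EuclideanSpace ℝ (Fin m) => f p.1 p.2)
    (hg : ∀ i, ContDiff ℝ 2
      fun p : EuclideanSpace ℝ (Fin n) × EuclideanSpace ℝ (Fin m) => g p.1 p.2 i) :
    ContDiff ℝ 2 fun w : PrimalDualSpace n m q => Lag f g w.1 w.2.1 w.2.2 := by
  have hp : ContDiff ℝ 2 fun w : PrimalDualSpace n m q => (w.1, w.2.1) := by fun_prop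
  unfold Lag
  refine (hf.comp hp).sub (ContDiff.sum fun i _ => ?_)
  exact (by fun_prop : ContDiff ℝ 2 fun w : PrimalDualSpace n m q => w.2.2 i).mul ((hg i).comp hp)

theorem gradyL_eq
    (hf : ContDiff ℝ 2 fun p : EuclideanSpace ℝ (Fin n) × EuclideanSpace ℝ (Fin m) => f p.1 p.2)
    (hg : ∀ i, ContDiff ℝ 2
      fun p : EuclideanSpace ℝ (Fin n) × EuclideanSpace ℝ (Fin m) => g p.1 p.2 i)
    (x : EuclideanSpace ℝ (Fin n)) (y : EuclideanSpace ℝ (Fin m)) (lam : Fin q → ℝ) :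
    gradyL f g x y lam = grady f x y - ∑ i, lam i • grady (fun x y => g x y i) x y := by
  have hp : DifferentiableAt ℝ (fun y' : EuclideanSpace ℝ (Fin m) => (x, y')) y := by fun_prop
  have hfd : DifferentiableAt ℝ (fun y' => f x y') y :=
    (hf.differentiable (by norm_num) (x, y)).comp y hp
  have hgd (i : Fin q) : DifferentiableAt ℝ (fun y' => g x y' i) y :=
    ((hg i).differentiable (by norm_num) (x, y)).comp y hp
  have hL : HasFDerivAt (fun y' => Lag f g x y' lam)
      (fderiv ℝ (fun y' => f x y') y - ∑ i, lam i • fderiv ℝ (fun y' => g x y' i) y) y :=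
    hfd.hasFDerivAt.sub (HasFDerivAt.fun_sum fun i _ => (hgd i).hasFDerivAt.const_mul (lam i))
  unfold gradyL grady gradient
  rw [hL.fderiv]
  simp

theorem contDiff_gradyL
    (hf : ContDiff ℝ 2 fun p : EuclideanSpace ℝ (Fin n) × EuclideanSpace ℝ (Fin m) => f p.1 p.2)
    (hg : ∀ i, ContDiff ℝ 2
      fun p : EuclideanSpace ℝ (Fin n) × EuclideanSpace ℝ (Fin m) => g p.1 p.2 i) :
    ContDiff ℝ 1 fun w : PrimalDualSpace n m q => gradyL f g w.1 w.2.1 w.2.2 := by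
  have hp : ContDiff ℝ 1 fun w : PrimalDualSpace n m q => (w.1, w.2.1) := by fun_prop
  simp only [gradyL_eq hf hg]
  refine ((contDiff_grady hf).comp hp).sub (ContDiff.sum fun i _ => ?_)
  exact (by fun_prop : ContDiff ℝ 1 fun w : PrimalDualSpace n m q => w.2.2 i).smul
    ((contDiff_grady (F := fun x y => g x y i) (hg i)).comp hp)

/-- Weak Wolfe duality. -/
theorem vfun_le_lag
    (hf : ContDiff ℝ 2 fun p : EuclideanSpace ℝ (Fin n) × EuclideanSpace ℝ (Fin m) => f p.1 p.2)
    (hg : ∀ i, ContDiff ℝ 2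
      fun p : EuclideanSpace ℝ (Fin n) × EuclideanSpace ℝ (Fin m) => g p.1 p.2 i)
    {x : EuclideanSpace ℝ (Fin n)} (hfc : ConcaveOn ℝ Set.univ (f x))
    (hgc : ∀ i, ConvexOn ℝ Set.univ fun y => g x y i)
    {y : EuclideanSpace ℝ (Fin m)} {lam : Fin q → ℝ} (hlam : ∀ i, 0 ≤ lam i)
    (hy : gradyL f g x y lam = 0) : Vfun f g x ≤ (Lag f g x y lam : EReal) := by
  have hconc : ConcaveOn ℝ Set.univ fun y' => Lag f g x y' lam := by
    have hs : ∀ s : Finset (Fin q), ConvexOn ℝ Set.univ fun y' => ∑ i ∈ s, lam i * g x y' i := by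
      intro s
      induction s using Finset.cons_induction with
      | empty => simpa using convexOn_const (0 : ℝ) convex_univ
      | cons a s ha ih =>
        simp only [Finset.sum_cons]
        exact ((hgc a).smul (hlam a)).add ih
    exact hfc.sub (hs Finset.univ)
  have hd : HasFDerivAt (fun y' => Lag f g x y' lam)
      (0 : EuclideanSpace ℝ (Fin m) →L[ℝ] ℝ) y := by
    have hdiff : DifferentiableAt ℝ (fun y' => Lag f g x y' lam) y :=
      DifferentiableAt.comp (g := fun w : PrimalDualSpace n m q => Lag f g w.1 w.2.1 w.2.2) y
        ((contDiff_lag hf hg).differentiable (by norm_num) (x, y, lam))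
        (by fun_prop : DifferentiableAt ℝ
          (fun y' : EuclideanSpace ℝ (Fin m) => (x, y', lam)) y)
    have h0 : gradient (fun y' => Lag f g x y' lam) y = 0 := hy
    have := hdiff.hasGradientAt.hasFDerivAt
    rwa [h0, map_zero] at this
  refine sSup_le ?_
  rintro _ ⟨y', hy', rfl⟩
  refine EReal.coe_le_coe_iff.2 (le_trans ?_ (hconc.le_of_fderiv_eq_zero hd y'))
  have : ∑ i, lam i * g x y' i ≤ 0 :=
    Finset.sum_nonpos fun i _ => mul_nonpos_of_nonneg_of_nonpos (hlam i) (hy' i)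
  simp only [Lag]
  linarith

end Lagrangian

/-- Theorem 3.4, regular subdifferential estimate via the Wolfe dual. -/
theorem stmt5 {n m q : ℕ}
    (f : EuclideanSpace ℝ (Fin n) → EuclideanSpace ℝ (Fin m) → ℝ)
    (g : EuclideanSpace ℝ (Fin n) → EuclideanSpace ℝ (Fin m) → Fin q → ℝ)
    (hf : ContDiff ℝ 2 (fun p : EuclideanSpace ℝ (Fin n) × EuclideanSpace ℝ (Fin m) => f p.1 p.2))
    (hg : ∀ i, ContDiff ℝ 2
      (fun p : EuclideanSpace ℝ (Fin n) × EuclideanSpace ℝ (Fin m) => g p.1 p.2 i))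
    (xb : EuclideanSpace ℝ (Fin n))
    (hconv : ∃ δ : ℝ, 0 < δ ∧ ∀ x ∈ Metric.ball xb δ,
      ConcaveOn ℝ Set.univ (f x) ∧ ∀ i, ConvexOn ℝ Set.univ (fun y => g x y i))
    (yb : EuclideanSpace ℝ (Fin m)) (lamb : Fin q → ℝ)
    (hyb : yb ∈ Sol f g xb) (hlamb : lamb ∈ SigmaSet f g xb yb)
    (hcq : CQAt (WolfeG n m q) (WolfeH f g) (xb, yb, lamb)) :
    FSub (Vfun f g) xb ⊆
      {v | ∃ u ∈ XiSet 1 f g xb yb lamb,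
        v = gradxL f g xb yb lamb + hessxyLu f g xb yb lamb u} := by
  rintro v ⟨c, hc, hv⟩
  obtain ⟨ρ, hρ, hconv⟩ := hconv
  have hfc : f xb yb = c := EReal.coe_injective (hyb.2.trans hc)
  obtain ⟨hgrad, hlam0, -, hcompl⟩ := hlamb
  let wb : PrimalDualSpace n m q := (xb, yb, lamb)
  obtain ⟨φ, hφ, hφ0, hφd, hφP⟩ := exists_contDiff_majorant
    (P := fun ε z => ((c + ⟪v, z⟫ - ε * ‖z‖ : ℝ) : EReal) ≤ Vfun f g (xb + z)) (by
      intro ε hε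
      obtain ⟨δ, hδ, h⟩ := hv ε hε
      exact ⟨δ, hδ, fun z hz => by simpa using h (xb + z) (by simpa using hz)⟩)
  let Λ : PrimalDualSpace n m q → ℝ := fun w => Lag f g w.1 w.2.1 w.2.2
  have hΛ : ContDiff ℝ 2 Λ := contDiff_lag hf hg
  have hΛd : DifferentiableAt ℝ Λ wb := hΛ.differentiable (by norm_num) wb
  let θ : PrimalDualSpace n m q → ℝ := fun w => Λ w - ⟪v, w.1 - xb⟫ + φ (w.1 - xb)
  have hθ : ContDiff ℝ 1 θ := by
    have hsub : ContDiff ℝ 1 fun w : PrimalDualSpace n m q => w.1 - xb := by fun_prop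
    exact ((hΛ.of_le (by norm_num)).sub (contDiff_const.inner ℝ hsub)).add (hφ.comp hsub)
  have hθb : θ wb = c := by
    simp [θ, Λ, wb, Lag, hφ0, hfc, hcompl]
  have hmin : IsLocalMinOn θ
      {w | (∀ i, WolfeG n m q w i ≤ 0) ∧ ∀ j, WolfeH f g w j = 0} wb := by
    have hsub : Tendsto (fun w : PrimalDualSpace n m q => w.1 - xb) (𝓝 wb) (𝓝 0) := by
      have : Continuous fun w : PrimalDualSpace n m q => w.1 - xb := by fun_prop
      simpa [wb] using this.tendsto wb
    have hball : ∀ᶠ w : PrimalDualSpace n m q in 𝓝 wb, w.1 ∈ Metric.ball xb ρ :=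
      continuous_fst.continuousAt.eventually (Metric.ball_mem_nhds xb hρ)
    have hev : ∀ᶠ w in 𝓝 wb, w ∈ {w | (∀ i, WolfeG n m q w i ≤ 0) ∧ ∀ j, WolfeH f g w j = 0} →
        θ wb ≤ θ w := by
      filter_upwards [hball, hsub.eventually hφP] with w hw ⟨ε, hP, hε⟩ hwS
      have hdual : Vfun f g w.1 ≤ (Λ w : EReal) :=
        vfun_le_lag hf hg (hconv w.1 hw).1 (hconv w.1 hw).2
          (fun i => neg_nonpos.1 (hwS.1 i)) (by ext j; exact hwS.2 j)
      rw [add_sub_cancel] at hP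
      have := EReal.coe_le_coe_iff.1 (hP.trans hdual)
      rw [hθb]
      simp only [θ]
      linarith
    exact eventually_nhdsWithin_iff.2 hev
  obtain ⟨α, μ, hα, hK, hαc⟩ := hcq θ hθ hmin
  let u : EuclideanSpace ℝ (Fin m) := WithLp.toLp 2 μ
  let Φ : PrimalDualSpace n m q → ℝ := fun w => ⟪gradyL f g w.1 w.2.1 w.2.2, u⟫
  have hgL : ContDiff ℝ 1 fun w : PrimalDualSpace n m q => gradyL f g w.1 w.2.1 w.2.2 :=
    contDiff_gradyL hf hg
  have hΦd : DifferentiableAt ℝ Φ wb :=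
    (hgL.inner ℝ contDiff_const).differentiable (by norm_num) wb
  have hH : ∑ j, μ j • fderiv ℝ (fun w => WolfeH f g w j) wb = fderiv ℝ Φ wb := by
    have hj (j : Fin m) : DifferentiableAt ℝ (fun w => WolfeH f g w j) wb :=
      differentiableAt_euclidean.1 (hgL.differentiable (by norm_num) wb) j
    have hsum : HasFDerivAt (fun w => ∑ j, μ j * WolfeH f g w j)
        (∑ j, μ j • fderiv ℝ (fun w => WolfeH f g w j) wb) wb :=
      HasFDerivAt.fun_sum fun j _ => (hj j).hasFDerivAt.const_mul (μ j)
    rw [← hsum.fderiv]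
    refine congrArg (fderiv ℝ · wb) (funext fun w => ?_)
    simp [Φ, u, WolfeH, PiLp.inner_apply]
  have hG (i : Fin q) (d : PrimalDualSpace n m q) :
      fderiv ℝ (fun w => WolfeG n m q w i) wb d = -d.2.2 i := by
    refine fderiv_apply_of_eq_add_mul ?_ fun t => ?_
    · unfold WolfeG
      fun_prop
    · simp [WolfeG, wb, add_comm]
  have hθ' (d : PrimalDualSpace n m q) : fderiv ℝ θ wb d = fderiv ℝ Λ wb d - ⟪v, d.1⟫ := by
    have hsub : HasFDerivAt (fun w : PrimalDualSpace n m q => w.1 - xb)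
        (ContinuousLinearMap.fst ℝ _ _) wb :=
      hasFDerivAt_fst.sub_const xb
    have hφb : HasFDerivAt φ (0 : EuclideanSpace ℝ (Fin n) →L[ℝ] ℝ) (wb.1 - xb) := by
      have h := (hφ.differentiable (by norm_num) 0).hasFDerivAt
      rw [hφd] at h
      simpa [wb] using h
    have h := (hΛd.hasFDerivAt.sub ((innerSL ℝ v).hasFDerivAt.comp wb hsub)).add
      (hφb.comp wb hsub)
    rw [ContinuousLinearMap.zero_comp, add_zero] at h
    exact DFunLike.congr_fun h.fderiv d
  have hkkt (d : PrimalDualSpace n m q) :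
      fderiv ℝ Λ wb d - ⟪v, d.1⟫ - ∑ i, α i * d.2.2 i + fderiv ℝ Φ wb d = 0 := by
    have h := DFunLike.congr_fun hK d
    change (fderiv ℝ θ wb + ∑ i, α i • fderiv ℝ (fun w => WolfeG n m q w i) wb +
      ∑ j, μ j • fderiv ℝ (fun w => WolfeH f g w j) wb) d = 0 at h
    rw [hH] at h
    simpa [hG, hθ', sub_eq_add_neg] using h
  have hx : HasFDerivAt (fun x' => ((x', yb, lamb) : PrimalDualSpace n m q))
      (ContinuousLinearMap.inl ℝ _ _) xb :=
    hasFDerivAt_prodMk_left xb (yb, lamb)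
  have hy : HasFDerivAt (fun y' => ((xb, y', lamb) : PrimalDualSpace n m q))
      ((ContinuousLinearMap.inr ℝ _ _).comp (ContinuousLinearMap.inl ℝ _ _)) yb :=
    (hasFDerivAt_prodMk_right xb (yb, lamb)).comp yb (hasFDerivAt_prodMk_left yb lamb)
  have hmult (i : Fin q) : α i = -(gyTu g xb yb u i) - 1 * g xb yb i := by
    have h1 : fderiv ℝ Λ wb (0, 0, Pi.single i 1) = -g xb yb i := by
      refine fderiv_apply_of_eq_add_mul hΛd fun t => ?_
      have := sum_add_smul_single_smul lamb t i (g xb yb)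
      simp only [smul_eq_mul] at this
      simp only [Λ, wb, Lag, Prod.fst_add, Prod.snd_add, Prod.smul_fst, Prod.smul_snd, smul_zero,
        add_zero, this]
      ring
    have h2 : fderiv ℝ Φ wb (0, 0, Pi.single i 1) = -gyTu g xb yb u i := by
      refine fderiv_apply_of_eq_add_mul hΦd fun t => ?_
      simp only [Φ, wb, gradyL_eq hf hg, Prod.fst_add, Prod.snd_add, Prod.smul_fst,
        Prod.smul_snd, smul_zero, add_zero, sum_add_smul_single_smul, gyTu, inner_sub_left,
        inner_add_left, real_inner_smul_left]
      ring
    have h3 := hkkt (0, 0, Pi.single i 1)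
    rw [h1, h2] at h3
    simp only [inner_zero_right, Pi.single_apply, mul_ite, mul_one, mul_zero,
      Finset.sum_ite_eq', Finset.mem_univ, if_true] at h3
    linarith
  refine ⟨u, ⟨?_, fun i => hmult i ▸ hα i, hlam0, ?_⟩, ?_⟩
  · refine ext_inner_right ℝ fun d => ?_
    have h1 : ⟪gradyL f g xb yb lamb, d⟫ = fderiv ℝ Λ wb (0, d, 0) :=
      inner_gradient_comp (T := Λ) (ι := fun y' => (xb, y', lamb)) hΛd hy d
    have h2 : ⟪hessyyLu f g xb yb lamb u, d⟫ = fderiv ℝ Φ wb (0, d, 0) :=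
      inner_gradient_comp (T := Φ) (ι := fun y' => (xb, y', lamb)) hΦd hy d
    have h3 := hkkt (0, d, 0)
    rw [← h1, ← h2, hgrad] at h3
    simpa using h3
  · have h : ∑ i, α i * -lamb i = 0 := hαc
    simp only [mul_neg, Finset.sum_neg_distrib, neg_eq_zero] at h
    simp_rw [← hmult, mul_comm (lamb _)]
    exact h
  · refine ext_inner_right ℝ fun d => ?_
    have h1 : ⟪gradxL f g xb yb lamb, d⟫ = fderiv ℝ Λ wb (d, 0, 0) :=
      inner_gradient_comp (T := Λ) (ι := fun x' => (x', yb, lamb)) hΛd hx d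
    have h2 : ⟪hessxyLu f g xb yb lamb u, d⟫ = fderiv ℝ Φ wb (d, 0, 0) :=
      inner_gradient_comp (T := Φ) (ι := fun x' => (x', yb, lamb)) hΦd hx d
    have h3 := hkkt (d, 0, 0)
    simp only [Pi.zero_apply, mul_zero, Finset.sum_const_zero] at h3
    rw [inner_add_left, h1, h2]
    linarith
end
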